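/- Let S be a countable set and let X = (X_0, X_1, …) be a transient partially exchangeable process taking values in S with non-random initial state X_0. Then every tail event of X, i.e. every event in ⋂_{n≥1} σ(X_n, X_{n+1}, …), agrees up to a null set with an event measurable with respect to the sigma-algebra generated by the transition numbers M(u,v) = #{i ≥ 0 : (X_i, X_{i+1}) = (u,v)}, u,v ∈ S. -/

import Mathlib

open MeasureTheory Filter Set
open scoped ENNReal

namespace DF

/-! ### Sequences over a countable state space -/

variable {S : Type}

/-- The number of transitions from `u` to `v` among the first `n` steps of the sequence `x`. -/
noncomputable def transCount (x : ℕ → S) (n : ℕ) (u v : S) : ℕ :=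
  Set.ncard {i : ℕ | i < n ∧ x i = u ∧ x (i + 1) = v}

/-- The equivalence `(x₀,…,xₙ) ≃ (y₀,…,yₙ)` of finite sequences: same initial state and the same
transition counts between every ordered pair of states. -/
def FinEquiv (x y : ℕ → S) (n : ℕ) : Prop :=
  x 0 = y 0 ∧ ∀ u v : S, transCount x n u v = transCount y n u v

/-- The equivalence `x ≃ y` of infinite sequences: they eventually agree and their initial
segments up to that point are `≃`-equivalent. -/
def InfEquiv (x y : ℕ → S) : Prop :=
  ∃ N : ℕ, (∀ n : ℕ, N ≤ n → x n = y n) ∧ FinEquiv x y N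

/-- The transition numbers `M(u,v) = #{i ≥ 0 : (xᵢ, xᵢ₊₁) = (u,v)}` of an infinite sequence. -/
noncomputable def transNum (x : ℕ → S) (u v : S) : ℕ∞ :=
  Set.encard {i : ℕ | x i = u ∧ x (i + 1) = v}

/-- The sigma-algebra on `S^ℕ` generated by the transition numbers. -/
noncomputable def transSigma (S : Type) : MeasurableSpace (ℕ → S) :=
  ⨆ u : S, ⨆ v : S, MeasurableSpace.comap (fun x => transNum x u v) (⊤ : MeasurableSpace ℕ∞)

/-- The tail sigma-algebra `⋂ₙ σ(Xₙ, Xₙ₊₁, …)` on `S^ℕ`. -/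
def tailSigma (S : Type) [MeasurableSpace S] : MeasurableSpace (ℕ → S) :=
  ⨅ n : ℕ, MeasurableSpace.comap (fun (x : ℕ → S) (i : ℕ) => x (i + n))
    (inferInstance : MeasurableSpace (ℕ → S))

/-- A measure on `S^ℕ` is partially exchangeable if any two `≃`-equivalent finite initial
segments have the same probability. -/
def PartiallyExchangeable [MeasurableSpace S] (μ : Measure (ℕ → S)) : Prop :=
  ∀ (n : ℕ) (x y : ℕ → S), FinEquiv x y n →
    μ {ω | ∀ i ≤ n, ω i = x i} = μ {ω | ∀ i ≤ n, ω i = y i}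

/-- The set of partially exchangeable probability measures on `S^ℕ`. -/
def PEProb (S : Type) [MeasurableSpace S] : Set (Measure (ℕ → S)) :=
  {μ | μ Set.univ = 1 ∧ PartiallyExchangeable μ}

/-- `μ` is an extreme point of the convex set of partially exchangeable probability measures. -/
def IsExtremePE [MeasurableSpace S] (μ : Measure (ℕ → S)) : Prop :=
  μ ∈ PEProb S ∧
    ∀ μ₁ ∈ PEProb S, ∀ μ₂ ∈ PEProb S, ∀ t : ℝ≥0∞, 0 < t → t < 1 →
      μ = t • μ₁ + (1 - t) • μ₂ → μ₁ = μ₂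

/-! ### Digraphs -/

/-- A digraph on vertex set `V` with edge set `E`: each edge has a tail (`src`) and head (`dst`).
Multiple edges and loops are allowed. -/
structure DigraphStruct (V E : Type) where
  src : E → V
  dst : E → V

namespace DigraphStruct

variable {V E : Type} (G : DigraphStruct V E)

def outEdges (v : V) : Set E := {e | G.src e = v}

def inEdges (v : V) : Set E := {e | G.dst e = v}

noncomputable def outDeg (v : V) : ℕ := (G.outEdges v).ncard

noncomputable def inDeg (v : V) : ℕ := (G.inEdges v).ncard

def LocallyFinite : Prop := ∀ v : V, (G.outEdges v).Finite ∧ (G.inEdges v).Finite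

/-- Adjacency in the underlying undirected graph. -/
def undirAdj (u v : V) : Prop :=
  ∃ e : E, (G.src e = u ∧ G.dst e = v) ∨ (G.src e = v ∧ G.dst e = u)

/-- `G` is connected as an undirected graph. -/
def Connected : Prop := ∀ u v : V, Relation.ReflTransGen G.undirAdj u v

def dirAdj (u v : V) : Prop := ∃ e : E, G.src e = u ∧ G.dst e = v

/-- One step along an edge of the edge set `B`. -/
def step (B : Set E) (u v : V) : Prop := ∃ e ∈ B, G.src e = u ∧ G.dst e = v

/-- `(G,o)` is an infinite sourced Eulerian digraph (with sink at infinity). -/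
structure IsSourcedEulerian (o : V) : Prop where
  infinite : Infinite V
  locFin : G.LocallyFinite
  conn : G.Connected
  balanced : ∀ v : V, v ≠ o → G.inDeg v = G.outDeg v
  source : G.outDeg o = G.inDeg o + 1

/-- The reversal of `G`: head and tail of every edge are exchanged. -/
def rev : DigraphStruct V E := ⟨G.dst, G.src⟩

/-- One-step transition probability of the random walk on `G`. -/
noncomputable def stepProb (u v : V) : ℝ≥0∞ :=
  ({e : E | G.src e = u ∧ G.dst e = v}.ncard : ℝ≥0∞) / (G.outDeg u : ℝ≥0∞)

open Classical in
/-- `μ` is the law of the random walk on `G` started at `o`, characterised through its cylinder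
probabilities. -/
def IsWalkLaw [MeasurableSpace V] (o : V) (μ : Measure (ℕ → V)) : Prop :=
  μ Set.univ = 1 ∧
    ∀ (n : ℕ) (x : ℕ → V),
      μ {ω | ∀ i ≤ n, ω i = x i} =
        if x 0 = o then ∏ i ∈ Finset.range n, G.stepProb (x i) (x (i + 1)) else 0

/-- `G` is transient: from every starting point, the random walk on `G` visits every vertex at
most finitely often almost surely. -/
def TransientDigraph [MeasurableSpace V] : Prop :=
  ∀ (o : V) (μ : Measure (ℕ → V)),
    G.IsWalkLaw o μ → μ {ω | ∀ v : V, {i : ℕ | ω i = v}.Finite} = 1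

/-- An infinite path in `G` indexed by `ℕ`, encoded by its sequence of edges. -/
def IsInfPath (γ : ℕ → E) : Prop := ∀ i : ℕ, G.dst (γ i) = G.src (γ (i + 1))

/-- A transient path: it visits every vertex at most finitely often. -/
def IsTransientPath (γ : ℕ → E) : Prop := ∀ v : V, {i : ℕ | G.src (γ i) = v}.Finite

/-- The edge set of the last-exit arboretum `𝓛(γ)`: the edges crossed by `γ` as it exits their
tail for the last time. -/
def lastExitSet (γ : ℕ → E) : Set E :=
  {e | ∃ i : ℕ, γ i = e ∧ ∀ j : ℕ, i < j → G.src (γ j) ≠ G.src (γ i)}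

end DigraphStruct

/-! ### Finite paths, Eulerian paths, arborescences -/

/-- `IsPathList G o z P` means that the list of edges `P` forms a directed path from `o`
to `z` in `G`. -/
def IsPathList {V E : Type} (G : DigraphStruct V E) : V → V → List E → Prop
  | o, z, [] => o = z
  | o, z, e :: es => G.src e = o ∧ IsPathList G (G.dst e) z es

/-- `P` is an Eulerian path from `o` to `z`: a path crossing every edge exactly once. -/
def IsEulerList {V E : Type} (G : DigraphStruct V E) (o z : V) (P : List E) : Prop :=
  IsPathList G o z P ∧ P.Nodup ∧ ∀ e : E, e ∈ P

/-- `B` is (the edge set of) a spanning in-arborescence of `G` rooted at `z`. -/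
def IsFinArb {V E : Type} (G : DigraphStruct V E) (z : V) (B : Set E) : Prop :=
  (∀ e ∈ B, G.src e ≠ z) ∧
  (∀ v : V, v ≠ z → ∃! e : E, e ∈ B ∧ G.src e = v) ∧
  (∀ v : V, Relation.ReflTransGen (G.step B) v z)

/-- `(G,o,z)` is a finite Eulerian digraph with source `o` and sink `z`. -/
structure IsFinEulerian {V E : Type} (G : DigraphStruct V E) (o z : V) : Prop where
  finV : Finite V
  finE : Finite E
  reach_from : ∀ v : V, Relation.ReflTransGen G.dirAdj o v
  reach_to : ∀ v : V, Relation.ReflTransGen G.dirAdj v z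
  bal_ne : o ≠ z → (∀ v : V, v ≠ o → v ≠ z → G.inDeg v = G.outDeg v) ∧
      G.outDeg o = G.inDeg o + 1 ∧ G.inDeg z = G.outDeg z + 1
  bal_eq : o = z → ∀ v : V, G.inDeg v = G.outDeg v

/-! ### Wired uniform spanning in-arborescences -/

/-- An exhaustion of the vertex set by finite subsets. -/
def IsExhaustion {V : Type} (Vn : ℕ → Set V) : Prop :=
  (∀ n, (Vn n).Finite) ∧ (∀ n, Vn n ⊆ Vn (n + 1)) ∧ (⋃ n, Vn n) = Set.univ

/-- `B` is (the edge set of) a spanning in-arborescence of the wired graph `G_U^*`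
(all vertices outside `U` identified to a single boundary vertex) rooted at the boundary. -/
def IsWiredArb {V E : Type} (G : DigraphStruct V E) (U : Set V) (B : Set E) : Prop :=
  (∀ e ∈ B, G.src e ∈ U) ∧ (∀ v ∈ U, ∃! e : E, e ∈ B ∧ G.src e = v) ∧
  (∀ v ∈ U, ∃ v' : V, v' ∉ U ∧ Relation.ReflTransGen (G.step B) v v')

/-- The probability, under the uniform spanning in-arborescence of the wired graph `G_U^*`
rooted at the boundary, that all edges of `F` are present. -/
noncomputable def wiredUACyl {V E : Type} (G : DigraphStruct V E) (U : Set V) (F : Finset E) :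
    ℝ≥0∞ :=
  (Nat.card {B : Set E // IsWiredArb G U B ∧ (F : Set E) ⊆ B} : ℝ≥0∞) /
    (Nat.card {B : Set E // IsWiredArb G U B} : ℝ≥0∞)

/-- `κ` is the law of the wired uniform spanning in-arboretum of `G` (as a random edge set,
encoded as an element of `E → Bool`): its cylinder probabilities are the limits along any
exhaustion of the uniform spanning in-arborescence measures of the wired graphs. -/
def IsWUALaw {V E : Type} (G : DigraphStruct V E) (κ : Measure (E → Bool)) : Prop :=
  κ Set.univ = 1 ∧
    ∀ Vn : ℕ → Set V, IsExhaustion Vn → ∀ F : Finset E,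
      Filter.Tendsto (fun n => wiredUACyl G (Vn n) F) Filter.atTop
        (nhds (κ {A | ∀ e ∈ F, A e = true}))

/-- A spanning in-arboretum rooted at infinity all of whose components are one-ended:
every vertex has out-degree exactly one, and the past of every vertex is finite. -/
def IsOneEndedSpanningArb {V E : Type} (G : DigraphStruct V E) (A : Set E) : Prop :=
  (∀ v : V, ∃! e : E, e ∈ A ∧ G.src e = v) ∧
    ∀ v : V, {u : V | Relation.ReflTransGen (G.step A) u v}.Finite

/-! ### Proper Gibbs measures on Eulerian paths -/

/-- `w` is a finite path in `G` starting at `o` (encoded by its edges). -/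
def PrefixPath {V E : Type} (G : DigraphStruct V E) (o : V) {n : ℕ} (w : Fin n → E) : Prop :=
  (∀ h : 0 < n, G.src (w ⟨0, h⟩) = o) ∧
    ∀ (i : ℕ) (h : i + 1 < n), G.dst (w ⟨i, Nat.lt_of_succ_lt h⟩) = G.src (w ⟨i + 1, h⟩)

/-- A proper Gibbs measure on Eulerian paths from `o` to `∞` in `G`: a probability measure on
edge sequences, supported on half-infinite paths started at `o` crossing every edge exactly once,
such that conditionally on the steps after time `n` the first `n` steps are a uniform Eulerian
path (from `o`, in the digraph spanned by the edges not crossed after time `n`, to the position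
at time `n`). Uniformity is expressed by invariance under replacing the first `n` steps by any
other path from `o` crossing the same set of edges. -/
def ProperGibbs {V E : Type} [MeasurableSpace E] (G : DigraphStruct V E) (o : V)
    (μ : Measure (ℕ → E)) : Prop :=
  μ Set.univ = 1 ∧
  μ {γ | (∀ i : ℕ, G.dst (γ i) = G.src (γ (i + 1))) ∧ G.src (γ 0) = o ∧ Function.Bijective γ}
      = 1 ∧
  ∀ (n : ℕ) (w w' : Fin n → E), Function.Injective w → Function.Injective w' →
    Set.range w = Set.range w' → PrefixPath G o w → PrefixPath G o w' →
    ∀ B : Set (ℕ → E),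
      μ {γ | (∀ i : Fin n, γ (i : ℕ) = w i) ∧ (fun t : ℕ => γ (n + t)) ∈ B} =
        μ {γ | (∀ i : Fin n, γ (i : ℕ) = w' i) ∧ (fun t : ℕ => γ (n + t)) ∈ B}

/-! ### Loop erasure and Wilson's algorithm rooted at infinity -/

/-- The loop-erasure times of the (transient) vertex sequence `p`:
`t₀ = 0`, `tᵢ₊₁ = 1 + max {t ≥ tᵢ : p t = p tᵢ}`. -/
noncomputable def leTimes {V : Type} (p : ℕ → V) : ℕ → ℕ
  | 0 => 0
  | i + 1 => sSup {t : ℕ | leTimes p i ≤ t ∧ p t = p (leTimes p i)} + 1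

/-- The loop-erasure times of the vertex sequence `p` run up to time `k`. -/
noncomputable def leTimesF {V : Type} (p : ℕ → V) (k : ℕ) : ℕ → ℕ
  | 0 => 0
  | i + 1 => sSup {t : ℕ | leTimesF p k i ≤ t ∧ t ≤ k ∧ p t = p (leTimesF p k i)} + 1

/-- The set of vertices incident to an edge of `A`. -/
def vertsOf {V E : Type} (G : DigraphStruct V E) (A : Set E) : Set V :=
  {u | ∃ e ∈ A, G.src e = u ∨ G.dst e = u}

open Classical in
/-- The set of edges of the loop-erasure of the walk `x` (an edge sequence) stopped when it
first hits `U`; if it never hits `U`, the loop-erasure of the whole (transient) walk. -/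
noncomputable def stoppedLEedges {V E : Type} (G : DigraphStruct V E) (U : Set V) (x : ℕ → E) :
    Set E :=
  if ∃ t : ℕ, G.src (x t) ∈ U then
    {e | ∃ i : ℕ,
      leTimesF (fun t => G.src (x t)) (sInf {t : ℕ | G.src (x t) ∈ U}) i <
          sInf {t : ℕ | G.src (x t) ∈ U} ∧
        x (leTimesF (fun t => G.src (x t)) (sInf {t : ℕ | G.src (x t) ∈ U}) i) = e}
  else Set.range fun i => x (leTimes (fun t => G.src (x t)) i)

/-- The partial edge sets generated by Wilson's algorithm rooted at infinity, run with the
enumeration `v` of the vertices and with `W j` the random walk used at stage `j + 1`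
(started at `v j`). -/
noncomputable def wilsonA {V E : Type} (G : DigraphStruct V E) (v : ℕ → V) (W : ℕ → ℕ → E) :
    ℕ → Set E
  | 0 => ∅
  | j + 1 =>
      wilsonA G v W j ∪
        stoppedLEedges G (vertsOf G (wilsonA G v W j) ∪ {u | ∃ i < j, v i = u}) (W j)

open Classical in
/-- Cylinder probabilities for the random walk on `G` started at `v`, recorded as a sequence of
edges: the probability that the first `n` crossed edges are `x 0, …, x (n-1)`. -/
noncomputable def edgeWalkCyl {V E : Type} (G : DigraphStruct V E) (v : V) (x : ℕ → E) (n : ℕ) :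
    ℝ≥0∞ :=
  if (0 < n → G.src (x 0) = v) ∧ (∀ i : ℕ, i + 1 < n → G.dst (x i) = G.src (x (i + 1))) then
    ∏ i ∈ Finset.range n, ((G.outDeg (G.src (x i)) : ℝ≥0∞))⁻¹
  else 0

/-- `P` is the joint law of a sequence of independent random walks on `G`, the `j`-th walk
started at `v j`. -/
def IsIndepWalksLaw {V E : Type} [MeasurableSpace E] (G : DigraphStruct V E) (v : ℕ → V)
    (P : Measure (ℕ → ℕ → E)) : Prop :=
  P Set.univ = 1 ∧
    ∀ (m n : ℕ) (x : ℕ → ℕ → E),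
      P {ω | ∀ j < m, ∀ t < n, ω j t = x j t} =
        ∏ j ∈ Finset.range m, edgeWalkCyl G (v j) (x j) n

/-- `μ` is the law of the random walk on `G` started at `o`, recorded as its sequence of crossed
edges. -/
def IsEdgeWalkLaw {V E : Type} [MeasurableSpace E] (G : DigraphStruct V E) (o : V)
    (μ : Measure (ℕ → E)) : Prop :=
  μ Set.univ = 1 ∧ ∀ (n : ℕ) (x : ℕ → E), μ {ω | ∀ i < n, ω i = x i} = edgeWalkCyl G o x n

/-! ### Finite approximations and Gibbs measures on arboreta -/

/-- A finite digraph with vertices and edges labelled by natural numbers. -/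
structure FinDigraph where
  VS : Finset ℕ
  ES : Finset ℕ
  fsrc : ℕ → ℕ
  fdst : ℕ → ℕ

/-- `B` is a spanning in-arborescence of the finite digraph `H` rooted at `z`. -/
def FinDigraph.IsArb (H : FinDigraph) (z : ℕ) (B : Finset ℕ) : Prop :=
  B ⊆ H.ES ∧ (∀ e ∈ B, H.fsrc e ≠ z) ∧
  (∀ v ∈ H.VS, v ≠ z → ∃! e : ℕ, e ∈ B ∧ H.fsrc e = v) ∧
  (∀ v ∈ H.VS, Relation.ReflTransGen
      (fun a b => ∃ e ∈ B, H.fsrc e = a ∧ H.fdst e = b) v z)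

/-- A finite digraph `H` with a distinguished vertex `z`, together with a partial isomorphism
to a digraph on `(V, E)`: vertex and edge domains `A`, `F` in `H` and maps `φV`, `φE` to `V`, `E`. -/
structure PIso (V E : Type) where
  H : FinDigraph
  z : ℕ
  A : Finset ℕ
  F : Finset ℕ
  φV : ℕ → V
  φE : ℕ → E

/-- The data of `p` really is a partial isomorphism to `G`. -/
def PIso.Valid {V E : Type} (p : PIso V E) (G : DigraphStruct V E) : Prop :=
  ↑p.A ⊆ ↑p.H.VS ∧ ↑p.F ⊆ ↑p.H.ES ∧ p.z ∈ p.H.VS ∧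
  Set.InjOn p.φV ↑p.A ∧ Set.InjOn p.φE ↑p.F ∧
  ∀ e ∈ p.F, p.H.fsrc e ∈ p.A ∧ p.H.fdst e ∈ p.A ∧
    G.src (p.φE e) = p.φV (p.H.fsrc e) ∧ G.dst (p.φE e) = p.φV (p.H.fdst e)

/-- The partial isomorphism `p` identifies a neighbourhood of (a preimage of) `w`:
`w` is in the range of `φV` and `φE` maps the edges incident to its preimage bijectively onto
the edges incident to `w`. -/
def PIso.GoodAt {V E : Type} (p : PIso V E) (G : DigraphStruct V E) (w : V) : Prop :=
  ∃ w' ∈ p.A, p.φV w' = w ∧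
    (∀ e' ∈ p.H.ES, (p.H.fsrc e' = w' ∨ p.H.fdst e' = w') → e' ∈ p.F) ∧
    ∀ e : E, (G.src e = w ∨ G.dst e = w) →
      ∃! e' : ℕ, e' ∈ p.F ∧ (p.H.fsrc e' = w' ∨ p.H.fdst e' = w') ∧ p.φE e' = e

/-- `a` is a finite approximation to `G`: a sequence of finite digraphs with distinguished
vertices `zₙ` and partial isomorphisms to `G`, identifying larger and larger neighbourhoods of
every finite vertex set, with the distinguished vertices escaping to infinity. -/
def IsFinApproxSeq {V E : Type} (G : DigraphStruct V E) (a : ℕ → PIso V E) : Prop :=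
  (∀ n, (a n).Valid G) ∧
  (∀ W : Finset V, ∃ N, ∀ n ≥ N, ∀ w ∈ W, (a n).GoodAt G w) ∧
  (∀ W : Finset V, ∃ N, ∀ n ≥ N, ¬((a n).z ∈ (a n).A ∧ (a n).φV (a n).z ∈ (W : Set V)))

/-- The probability, under the uniform spanning in-arborescence of `p.H` rooted at `p.z`, that
every edge of `F` is in the image of the arborescence under the partial isomorphism. -/
noncomputable def pisoUACyl {V E : Type} (p : PIso V E) (F : Finset E) :
    ℝ≥0∞ :=
  (Nat.card {B : Finset ℕ // p.H.IsArb p.z B ∧ ∀ e ∈ F, ∃ e' ∈ B, e' ∈ p.F ∧ p.φE e' = e} :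
      ℝ≥0∞) /
    (Nat.card {B : Finset ℕ // p.H.IsArb p.z B} : ℝ≥0∞)

/-- `μ` (a measure on edge sets, encoded as elements of `E → Bool`) is a Gibbs measure on
spanning in-arboreta of `G` rooted at infinity: it is a weak limit of mixtures (over a random
finite approximation to `G`) of uniform spanning in-arborescence measures on finite
approximations to `G`. -/
def IsArbGibbs {V E : Type} (G : DigraphStruct V E) (μ : Measure (E → Bool)) : Prop :=
  μ Set.univ = 1 ∧
  ∃ (Ω : Type) (mΩ : MeasurableSpace Ω) (ν : @Measure Ω mΩ) (a : Ω → ℕ → PIso V E),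
    ν Set.univ = 1 ∧ (∀ ω : Ω, IsFinApproxSeq G (a ω)) ∧
    ∀ F : Finset E,
      Filter.Tendsto (fun n => ∫⁻ ω, pisoUACyl (a ω n) F ∂ν) Filter.atTop
        (nhds (μ {A : E → Bool | ∀ e ∈ F, A e = true}))

/-! ### Stacks -/

open Classical in
/-- The state (current vertex, remaining stacks) after `n` steps of following the stacks `σ`
starting from `o`: at each step we cross the edge at the front of the list at the current vertex
and delete it from the list (doing nothing if the list is empty). -/
noncomputable def stackState {V E : Type} (G : DigraphStruct V E) (o : V) (σ : V → List E) :
    ℕ → V × (V → List E)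
  | 0 => (o, σ)
  | n + 1 =>
    let p := stackState G o σ n
    match p.2 p.1 with
    | [] => p
    | e :: rest => (G.dst e, Function.update p.2 p.1 rest)

/-- The edge crossed at step `n` when following the stacks `σ` from `o` (`none` if the
current stack is exhausted). -/
noncomputable def stackEdge {V E : Type} (G : DigraphStruct V E) (o : V) (σ : V → List E)
    (n : ℕ) : Option E :=
  ((stackState G o σ n).2 (stackState G o σ n).1).head?

/-- The sigma-algebra on stack configurations. -/
noncomputable def stackMS (V E : Type) : MeasurableSpace (V → List E) :=
  @MeasurableSpace.pi V (fun _ => List E) fun _ => ⊤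

open Classical in
/-- `ρ` is the law of the random stack configuration built from a random arboretum with law `κ`:
place the arboretum edge at the bottom of the stack at each vertex, and an independent,
uniformly random ordering of the remaining outgoing edges on top of it. -/
def IsStackLaw {V E : Type} (G : DigraphStruct V E) (κ : Measure (E → Bool))
    (ρ : @Measure (V → List E) (stackMS V E)) : Prop :=
  ρ Set.univ = 1 ∧
    ∀ (K : Finset V) (s : V → List E),
      ρ {σ | ∀ v ∈ K, σ v = s v} =
        if ∀ v ∈ K, (s v).Nodup ∧ ∀ e : E, e ∈ s v ↔ G.src e = v then
          κ {A | ∀ v ∈ K, ∃ e : E, (s v).getLast? = some e ∧ A e = true} *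
            ∏ v ∈ K, (((G.outDeg v - 1).factorial : ℝ≥0∞))⁻¹
        else 0

/-! ### Markov chains -/

open Classical in
/-- `ν` is the law of the trajectory of a Markov chain with state space `S' ⊆ S`, transition
kernel `p` and deterministic initial state `s0`. -/
def IsMCLaw {S : Type} [MeasurableSpace S] (S' : Set S) (p : S → S → ℝ≥0∞) (s0 : S)
    (ν : Measure (ℕ → S)) : Prop :=
  ν Set.univ = 1 ∧ s0 ∈ S' ∧
  (∀ u ∈ S', (∑' v : S, p u v) = 1 ∧ ∀ v : S, p u v ≠ 0 → v ∈ S') ∧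
  (∀ u : S, u ∉ S' → ∀ v : S, p u v = 0) ∧
  ∀ (n : ℕ) (y : ℕ → S),
    ν {x | ∀ i ≤ n, x i = y i} =
      if y 0 = s0 then ∏ i ∈ Finset.range n, p (y i) (y (i + 1)) else 0

/-- `ν` is the law of the trajectory of a recurrent Markov chain on a subset of `S` with
non-random initial state: the chain returns to its initial state infinitely often a.s. -/
def IsRecMCLaw {S : Type} [MeasurableSpace S] (ν : Measure (ℕ → S)) : Prop :=
  ∃ (S' : Set S) (p : S → S → ℝ≥0∞) (s0 : S),
    IsMCLaw S' p s0 ν ∧ ν {x | {i : ℕ | x i = s0}.Infinite} = 1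

/-- `ν` is the law of the sequence of vertices visited by (the unique) proper Gibbs measure on
Eulerian paths from `o` to `∞` on a sourced Eulerian digraph whose vertex set is a subset
of `S`. -/
def IsGibbsVertexLaw {S : Type} [MeasurableSpace S] (ν : Measure (ℕ → S)) : Prop :=
  ∃ (Vs : Set S) (E : Type) (mE : MeasurableSpace E) (G : DigraphStruct (↥Vs) E) (o : ↥Vs),
    Countable E ∧ G.IsSourcedEulerian o ∧
    ∃ μp : @Measure (ℕ → E) (@MeasurableSpace.pi ℕ (fun _ => E) fun _ => mE),
      @ProperGibbs (↥Vs) E mE G o μp ∧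
      ∀ A : Set (ℕ → S), MeasurableSet A →
        ν A = μp ((fun (γ : ℕ → E) (i : ℕ) => ((G.src (γ i) : S))) ⁻¹' A)

/-- Concatenation of a finite list with an infinite sequence. -/
def concatSeq {S : Type} (l : List S) (y : ℕ → S) : ℕ → S :=
  fun i => if h : i < l.length then l.get ⟨i, h⟩ else y (i - l.length)

/-- `ν` is the law of a process following a uniform random Eulerian path on a finite Eulerian
digraph with source and sink whose vertex set is a subset of `S`, followed by the trajectory of
an (independent) recurrent Markov chain on a disjoint subset of `S` with non-random initial
state. -/
def IsMixedLaw {S : Type} [MeasurableSpace S] (ν : Measure (ℕ → S)) : Prop :=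
  ∃ (Vf : Finset S) (Ef : Type) (_ : Finite Ef)
    (Gf : DigraphStruct {s : S // s ∈ Vf} Ef) (of zf : {s : S // s ∈ Vf})
    (Vr : Set S) (p : S → S → ℝ≥0∞) (s1 : S) (νMC : Measure (ℕ → S)),
    IsFinEulerian Gf of zf ∧ Disjoint (↑Vf : Set S) Vr ∧
    IsMCLaw Vr p s1 νMC ∧ νMC {x | {i : ℕ | x i = s1}.Infinite} = 1 ∧
    ∀ A : Set (ℕ → S), MeasurableSet A →
      ν A =
        (∑' L : {L : List Ef // IsEulerList Gf of zf L},
            νMC ((fun y => concatSeq (((of : S)) ::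
              (L : List Ef).map fun e => ((Gf.dst e : S))) y) ⁻¹' A)) /
          (Nat.card {L : List Ef // IsEulerList Gf of zf L} : ℝ≥0∞)


section


/-! ### Stacks of successors -/

open Classical in
/-- The list of successors of `v` along the first `n` steps of `x`. -/
noncomputable def stk (x : ℕ → S) (n : ℕ) (v : S) : List S :=
  ((List.range n).filter (fun i => decide (x i = v))).map (fun i => x (i + 1))

/-- Last-edge relation of a stack configuration. -/
def lstep (σ : S → List S) (u w : S) : Prop := (σ u).getLast? = some w

@[simp] lemma stk_zero (x : ℕ → S) (v : S) : stk x 0 v = [] := by simp [stk]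

open Classical in
lemma stk_succ (x : ℕ → S) (n : ℕ) (v : S) :
    stk x (n + 1) v = stk x n v ++ (if x n = v then [x (n + 1)] else []) := by
  unfold stk
  rw [List.range_succ, List.filter_append, List.map_append]
  congr 1
  by_cases h : x n = v <;> simp [h]

open Classical in
lemma stk_succ' (x : ℕ → S) (n : ℕ) (v : S) :
    stk x (n + 1) v = (if x 0 = v then [x 1] else []) ++ stk (fun i => x (i + 1)) n v := by
  induction n with
  | zero => simp [stk_succ]
  | succ n ih => rw [stk_succ, ih, stk_succ (fun i => x (i + 1)) n v, List.append_assoc]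

lemma stk_add (x : ℕ → S) (n k : ℕ) (v : S) :
    stk x (n + k) v = stk x n v ++ stk (fun i => x (n + i)) k v := by
  induction k with
  | zero => simp
  | succ k ih =>
    rw [← Nat.add_assoc, stk_succ, ih, stk_succ (fun i => x (n + i)) k v, List.append_assoc]
    rfl

lemma stk_congr {x y : ℕ → S} {n : ℕ} (h : ∀ i ≤ n, x i = y i) (v : S) :
    stk x n v = stk y n v := by
  induction n with
  | zero => simp
  | succ n ih =>
    rw [stk_succ, stk_succ, ih (fun i hi => h i (by omega)), h n (by omega), h (n + 1) le_rfl]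

lemma mem_stk {x : ℕ → S} {n : ℕ} {v w : S} :
    w ∈ stk x n v ↔ ∃ i < n, x i = v ∧ x (i + 1) = w := by
  simp [stk, and_assoc]

lemma stk_ne_nil {x : ℕ → S} {n : ℕ} {v : S} : stk x n v ≠ [] ↔ ∃ i < n, x i = v := by
  simp [stk]

lemma transCount_succ (x : ℕ → S) (n : ℕ) (u v : S) [Decidable (x n = u ∧ x (n + 1) = v)] :
    transCount x (n + 1) u v = transCount x n u v + if x n = u ∧ x (n + 1) = v then 1 else 0 := by
  unfold transCount
  have hfin : {i : ℕ | i < n ∧ x i = u ∧ x (i + 1) = v}.Finite :=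
    (Set.finite_lt_nat n).subset (fun i hi => hi.1)
  split_ifs with h
  · rw [← Set.ncard_insert_of_notMem (a := n) (by simp) hfin]
    congr 1
    ext i
    simp only [Set.mem_setOf_eq, Set.mem_insert_iff]
    constructor
    · rintro ⟨h1, h2⟩
      rcases Nat.lt_succ_iff_lt_or_eq.1 h1 with h3 | h3
      · exact Or.inr ⟨h3, h2⟩
      · exact Or.inl h3
    · rintro (h1 | h1)
      · subst h1; exact ⟨by omega, h⟩
      · exact ⟨by omega, h1.2⟩
  · rw [Nat.add_zero]
    congr 1
    ext i
    simp only [Set.mem_setOf_eq]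
    constructor
    · rintro ⟨h1, h2⟩
      rcases Nat.lt_succ_iff_lt_or_eq.1 h1 with h3 | h3
      · exact ⟨h3, h2⟩
      · subst h3; exact absurd h2 h
    · rintro h1
      exact ⟨by omega, h1.2⟩

open Classical in
lemma transCount_eq (x : ℕ → S) (n : ℕ) (u v : S) :
    transCount x n u v = (stk x n u).count v := by
  induction n with
  | zero => simp [transCount]
  | succ n ih =>
    rw [transCount_succ, ih, stk_succ, List.count_append]
    congr 1
    by_cases h : x n = u <;> by_cases h' : x (n + 1) = v <;> simp [h, h']

lemma finEquiv_iff (x y : ℕ → S) (n : ℕ) :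
    FinEquiv x y n ↔ x 0 = y 0 ∧ ∀ v, (stk x n v).Perm (stk y n v) := by
  classical
  unfold FinEquiv
  simp_rw [List.perm_iff_count, transCount_eq]

lemma getLast_stk {x : ℕ → S} {n : ℕ} {u w : S} :
    lstep (stk x n) u w ↔
      ∃ i < n, x i = u ∧ x (i + 1) = w ∧ ∀ j, i < j → j < n → x j ≠ u := by
  unfold lstep
  induction n with
  | zero => simp
  | succ n ih =>
    rw [stk_succ]
    by_cases h : x n = u
    · simp only [h, if_true, List.getLast?_append, List.getLast?_singleton, Option.some_or,
        Option.some.injEq]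
      constructor
      · intro h'
        exact ⟨n, by omega, h, h', fun j h1 h2 => by omega⟩
      · rintro ⟨i, hi, h1, h2, h3⟩
        rcases Nat.lt_succ_iff_lt_or_eq.1 hi with h4 | h4
        · exact absurd h (h3 n h4 (by omega))
        · subst h4; exact h2
    · simp only [h, if_false, List.append_nil, ih]
      constructor
      · rintro ⟨i, hi, h1, h2, h3⟩
        refine ⟨i, by omega, h1, h2, fun j hj hj' => ?_⟩
        rcases Nat.lt_succ_iff_lt_or_eq.1 hj' with h4 | h4
        · exact h3 j hj h4
        · subst h4; exact h
      · rintro ⟨i, hi, h1, h2, h3⟩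
        rcases Nat.lt_succ_iff_lt_or_eq.1 hi with h4 | h4
        · exact ⟨i, h4, h1, h2, fun j hj hj' => h3 j hj (by omega)⟩
        · subst h4; exact absurd h1 h

/-- A path is determined by its starting point and its stacks. -/
lemma eq_of_stk_eq {n : ℕ} {x y : ℕ → S} (h0 : x 0 = y 0)
    (h : ∀ v, stk x n v = stk y n v) : ∀ i ≤ n, x i = y i := by
  induction n generalizing x y with
  | zero => intro i hi; obtain rfl : i = 0 := by omega
            exact h0
  | succ n ih =>
    have h1 : x 1 = y 1 ∧ ∀ v, stk (fun i => x (i + 1)) n v = stk (fun i => y (i + 1)) n v := by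
      constructor
      · have := h (x 0)
        rw [stk_succ', stk_succ', ← h0] at this
        simp at this
        exact this.1
      · intro v
        have := h v
        rw [stk_succ', stk_succ', ← h0] at this
        by_cases hv : x 0 = v
        · simp [hv] at this; exact this.2
        · simpa [hv] using this
    intro i hi
    cases i with
    | zero => exact h0
    | succ i => exact ih (x := fun i => x (i + 1)) (y := fun i => y (i + 1)) h1.1 h1.2 i (by omega)

lemma leads_stk {x : ℕ → S} {n : ℕ} {i : ℕ} (hi : i ≤ n) :
    Relation.ReflTransGen (lstep (stk x n)) (x i) (x n) := by
  induction hk : n - i using Nat.strong_induction_on generalizing i with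
  | _ k ih =>
    by_cases h : i = n
    · subst h; exact .refl
    · -- last visit
      classical
      let T := (Finset.range n).filter (fun j => x j = x i)
      have hT : T.Nonempty := ⟨i, by simp [T]; omega⟩
      set j := T.max' hT with hj
      have hjT : j ∈ T := T.max'_mem hT
      have hjm : ∀ l ∈ T, l ≤ j := fun l hl => T.le_max' l hl
      have hij : i ≤ j := hjm i (by simp [T]; omega)
      simp only [T, Finset.mem_filter, Finset.mem_range] at hjT hjm
      have hs : lstep (stk x n) (x i) (x (j + 1)) :=
        getLast_stk.2 ⟨j, hjT.1, hjT.2, rfl, fun l h1 h2 h3 => by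
          have := hjm l ⟨h2, h3⟩; omega⟩
      exact Relation.ReflTransGen.head hs (ih (n - (j + 1)) (by omega) (by omega) rfl)

open Classical in
lemma balance_stk (x : ℕ → S) (n : ℕ) (U : Finset S) (hU : ∀ i < n, x i ∈ U) (v : S) :
    (stk x n v).length + (if v = x n then 1 else 0) =
      ∑ u ∈ U, (stk x n u).count v + (if v = x 0 then 1 else 0) := by
  induction n with
  | zero => simp
  | succ n ih =>
    have ih := ih (fun i hi => hU i (by omega))
    simp_rw [stk_succ, List.count_append, Finset.sum_add_distrib, List.length_append]
    have e1 : ∑ u ∈ U, List.count v (if x n = u then [x (n + 1)] else []) =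
        if v = x (n + 1) then 1 else 0 := by
      rw [Finset.sum_eq_single (x n)]
      · by_cases h : v = x (n + 1)
        · simp [h]
        · simp [h, Ne.symm h]
      · intro b _ hb; simp [Ne.symm hb]
      · intro h; exact absurd (hU n (by omega)) h
    have e2 : (if x n = v then [x (n + 1)] else []).length = if v = x n then 1 else 0 := by
      by_cases h : v = x n
      · simp [h]
      · simp [h, Ne.symm h]
    rw [e1, e2]
    omega

open Classical in
lemma length_stk_sum (x : ℕ → S) (n : ℕ) (U : Finset S) (hU : ∀ i < n, x i ∈ U) :
    ∑ u ∈ U, (stk x n u).length = n := by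
  induction n with
  | zero => simp
  | succ n ih =>
    have ih := ih (fun i hi => hU i (by omega))
    simp_rw [stk_succ, List.length_append, Finset.sum_add_distrib, ih]
    rw [Finset.sum_eq_single (x n)]
    · simp
    · intro b _ hb; simp [Ne.symm hb]
    · intro h; exact absurd (hU n (by omega)) h

/-- prepend a state to a sequence -/
def consSeq (o : S) (y : ℕ → S) : ℕ → S
  | 0 => o
  | n + 1 => y n

open Classical in
/-- Combinatorial part of the BEST theorem: balanced stacks whose last edges lead to `z`
are the stacks of a path ending at `z`. -/
lemma best (U : Finset S) (n : ℕ) : ∀ (σ : S → List S) (o z : S), (∀ u ∉ U, σ u = []) →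
    ∑ u ∈ U, (σ u).length = n →
    (∀ v, (σ v).length + (if v = z then 1 else 0) =
      ∑ u ∈ U, (σ u).count v + (if v = o then 1 else 0)) →
    (∀ v, σ v ≠ [] → Relation.ReflTransGen (lstep σ) v z) →
    ∃ y : ℕ → S, y 0 = o ∧ y n = z ∧ ∀ v, stk y n v = σ v := by
  induction n with
  | zero =>
    intro σ o z hU hn hb ht
    have hnil : ∀ v, σ v = [] := by
      intro v
      by_cases hv : v ∈ U
      · have := (Finset.sum_eq_zero_iff.1 hn) v hv
        exact List.length_eq_zero_iff.1 this
      · exact hU v hv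
    have := hb o
    simp only [hnil, List.length_nil, List.count_nil, Finset.sum_const_zero, if_true] at this
    have hoz : o = z := by
      by_contra h
      simp [h] at this
    exact ⟨fun _ => o, rfl, hoz, fun v => by simp [hnil]⟩
  | succ n ih =>
    intro σ o z hU hn hb ht
    have hcnt : ∀ u w, w ∈ σ u → 1 ≤ ∑ u ∈ U, (σ u).count w := by
      intro u w hw
      have hu : u ∈ U := by
        by_contra h; rw [hU u h] at hw; simp at hw
      calc 1 ≤ (σ u).count w := List.one_le_count_iff.2 hw
        _ ≤ _ := Finset.single_le_sum (f := fun u => (σ u).count w) (fun _ _ => Nat.zero_le _) hu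
    cases hσ : σ o with
    | nil =>
      exfalso
      have h1 := hb o
      rw [hσ] at h1
      simp only [List.length_nil, if_true] at h1
      have hoz : o = z := by
        by_contra h
        simp [h] at h1
      subst hoz
      simp only [if_true] at h1
      obtain ⟨v, hv⟩ : ∃ v, σ v ≠ [] := by
        by_contra hcon
        push Not at hcon
        simp [hcon] at hn
      have hl := ht v hv
      rcases Relation.ReflTransGen.cases_tail hl with h | ⟨c, _, hc⟩
      · subst h; exact hv hσ
      · have := hcnt c o (List.mem_of_getLast? hc)
        omega
    | cons w rest =>
      set σ' := Function.update σ o rest with hσ'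
      have hoU : o ∈ U := by
        by_contra h; rw [hU o h] at hσ; simp at hσ
      have hne : ∀ v, v ≠ o → σ' v = σ v := fun v hv => by simp [hσ', hv]
      have heq : σ' o = rest := by simp [hσ']
      have hcnt' : ∀ v, ∑ u ∈ U, (σ u).count v = ∑ u ∈ U, (σ' u).count v +
          (if v = w then 1 else 0) := by
        intro v
        rw [← Finset.add_sum_erase _ _ hoU, ← Finset.add_sum_erase (a := o) _ _ hoU, hσ, heq,
          List.count_cons]
        have : ∑ x ∈ U.erase o, List.count v (σ x) = ∑ x ∈ U.erase o, List.count v (σ' x) :=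
          Finset.sum_congr rfl (fun x hx => by rw [hne x (Finset.ne_of_mem_erase hx)])
        rw [this]
        by_cases h : v = w
        · simp [h]; omega
        · simp [h, Ne.symm h]
      obtain ⟨y, hy0, hyn, hys⟩ := ih σ' w z
        (by intro u hu
            have : u ≠ o := fun h => hu (h ▸ hoU)
            rw [hne u this]; exact hU u hu)
        (by rw [← Finset.add_sum_erase _ _ hoU, hσ] at hn
            rw [← Finset.add_sum_erase _ _ hoU, heq]
            have : ∑ x ∈ U.erase o, (σ x).length = ∑ x ∈ U.erase o, (σ' x).length :=
              Finset.sum_congr rfl (fun x hx => by rw [hne x (Finset.ne_of_mem_erase hx)])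
            rw [← this]
            simp only [List.length_cons] at hn
            omega)
        (by intro v
            have h1 := hb v
            rw [hcnt' v] at h1
            by_cases h : v = o
            · subst h
              rw [hσ] at h1
              rw [heq]
              simp only [List.length_cons, if_true] at h1
              omega
            · rw [hne v h]
              simp only [h, if_false] at h1
              omega)
        (by intro v hv
            by_cases hrest : rest = []
            · -- the stack at o is exhausted
              have hio : o ≠ z → ∑ u ∈ U, (σ u).count o = 0 := by
                intro hoz
                have h1 := hb o
                rw [hσ, hrest] at h1
                simpa [hoz] using h1
              have hvo : v ≠ o := by
                rintro rfl
                rw [heq] at hv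
                exact hv hrest
              have key : ∀ a, Relation.ReflTransGen (lstep σ) a z → (a ≠ o ∨ o = z) →
                  Relation.ReflTransGen (lstep σ') a z := by
                intro a ha
                induction ha using Relation.ReflTransGen.head_induction_on with
                | refl => intro _; exact .refl
                | head hab hbz ihb =>
                  rename_i a b
                  intro hao
                  by_cases h : a = o
                  · rcases hao with h' | h'
                    · exact absurd h h'
                    · rw [h, h']
                  · have hb' : b ≠ o ∨ o = z := by
                      by_contra hcon
                      push Not at hcon
                      have := hio hcon.2
                      have h2 := hcnt a b (List.mem_of_getLast? hab)
                      rw [hcon.1] at h2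
                      omega
                    refine Relation.ReflTransGen.head ?_ (ihb hb')
                    unfold lstep
                    rw [hne a h]
                    exact hab
              have hv' : σ v ≠ [] := by rwa [hne v hvo] at hv
              exact key v (ht v hv') (Or.inl hvo)
            · have hl : lstep σ' = lstep σ := by
                funext a b
                unfold lstep
                by_cases h : a = o
                · subst h
                  rw [heq, hσ]
                  cases rest with
                  | nil => exact absurd rfl hrest
                  | cons c l => simp [List.getLast?_cons_cons]
                · rw [hne a h]
              rw [hl]
              apply ht
              by_cases h : v = o
              · subst h; rw [hσ]; simp
              · rwa [← hne v h])
      refine ⟨consSeq o y, rfl, hyn, fun v => ?_⟩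
      rw [stk_succ']
      have : (fun i => consSeq o y (i + 1)) = y := rfl
      rw [this, hys v]
      by_cases h : v = o
      · subst h
        simp [consSeq, heq, hσ, hy0]
      · have h' : ¬ (consSeq o y 0 = v) := fun h2 => h h2.symm
        rw [if_neg h', hne v h]; simp
end

section
open Classical in
/-- Vertices of `V` that are not reached from outside of `V`. -/
noncomputable def Dset (V : Finset S) (ℓ : S → S → Prop) : Finset S :=
  V.filter (fun v => ¬ ∃ u, u ∉ V ∧ Relation.ReflTransGen (fun a b => ℓ a b ∧ b ∈ V) u v)

/-- no closed subset. -/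
def Good (D : Finset S) (ℓ : S → S → Prop) : Prop :=
  ∀ T : Finset S, T ⊆ D → (∀ v ∈ T, ∃ w ∈ T, ℓ v w) → T = ∅

lemma Dset_subset (V : Finset S) (ℓ : S → S → Prop) : Dset V ℓ ⊆ V := by
  classical
  exact Finset.filter_subset _ _

lemma notMem_Dset {V : Finset S} {ℓ : S → S → Prop} {v : S} (h : v ∉ Dset V ℓ) (hv : v ∈ V) :
    ∃ u, u ∉ V ∧ Relation.ReflTransGen (fun a b => ℓ a b ∧ b ∈ V) u v := by
  classical
  by_contra hc
  exact h (Finset.mem_filter.2 ⟨hv, hc⟩)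

lemma Dset_step {V : Finset S} {ℓ : S → S → Prop} {v w : S} (hv : v ∉ Dset V ℓ) (h : ℓ v w) :
    w ∉ Dset V ℓ := by
  classical
  intro hw
  have hw' := Finset.mem_filter.1 hw
  apply hw'.2
  by_cases hvV : v ∈ V
  · obtain ⟨u, hu, hp⟩ := notMem_Dset hv hvV
    exact ⟨u, hu, hp.tail ⟨h, hw'.1⟩⟩
  · exact ⟨v, hvV, .single ⟨h, hw'.1⟩⟩

lemma Dset_congr {V : Finset S} {ℓ ℓ' : S → S → Prop} 
    (h : ∀ v ∉ Dset V ℓ, ∀ w, ℓ' v w ↔ ℓ v w) : Dset V ℓ' = Dset V ℓ := by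
  classical
  ext v
  constructor
  · intro hv
    have hv' := Finset.mem_filter.1 hv
    by_contra hc
    obtain ⟨u, hu, hp⟩ := notMem_Dset hc hv'.1
    apply hv'.2
    refine ⟨u, hu, ?_⟩
    have huD : u ∉ Dset V ℓ := fun h => hu (Dset_subset _ _ h)
    clear hv hv' hc
    have : Relation.ReflTransGen (fun a b => ℓ' a b ∧ b ∈ V) u v ∧ v ∉ Dset V ℓ := by
      induction hp with
      | refl => exact ⟨.refl, huD⟩
      | tail _ hs ih => exact ⟨ih.1.tail ⟨(h _ ih.2 _).2 hs.1, hs.2⟩, Dset_step ih.2 hs.1⟩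
    exact this.1
  · intro hv
    have hv' := Finset.mem_filter.1 hv
    refine Finset.mem_filter.2 ⟨hv'.1, ?_⟩
    rintro ⟨u, hu, hp⟩
    have huD : u ∉ Dset V ℓ := fun h => hu (Dset_subset _ _ h)
    have : v ∉ Dset V ℓ := by
      clear hv hv'
      induction hp with
      | refl => exact huD
      | tail _ hs ih => exact Dset_step ih ((h _ ih _).1 hs.1)
    exact this hv

lemma good_stk {x : ℕ → S} {n : ℕ} {V : Finset S} (hn : x n ∉ V) {D : Finset S} (hD : D ⊆ V) :
    Good D (lstep (stk x n)) := by
  intro T hT hcl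
  by_contra hne
  obtain ⟨v, hv⟩ := Finset.nonempty_iff_ne_empty.2 hne
  obtain ⟨w, _, hw⟩ := hcl v hv
  have h1 : stk x n v ≠ [] := by
    intro h; unfold lstep at hw; simp [h] at hw
  obtain ⟨i, hi, rfl⟩ := stk_ne_nil.1 h1
  have hp := leads_stk (x := x) hi.le
  have : x n ∈ T := by
    clear hw h1
    generalize x n = z at hp
    induction hp with
    | refl => exact hv
    | tail _ hs ih =>
      obtain ⟨w', hw', h'⟩ := hcl _ ih
      unfold lstep at hs h'
      rw [hs] at h'
      simp at h'
      exact h' ▸ hw'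
  exact hn (hD (hT this))

lemma restack {x : ℕ → S} {n : ℕ} {V : Finset S} (hn : x n ∉ V) {D : Finset S}
    (hD : D = Dset V (lstep (stk x n))) (s : S → List S) (hs : ∀ v ∈ D, (s v).Perm (stk x n v))
    (hg : Good D (lstep s)) :
    ∃ y : ℕ → S, y 0 = x 0 ∧ y n = x n ∧ (∀ v ∈ D, stk y n v = s v) ∧
      (∀ v ∉ D, stk y n v = stk x n v) ∧ Dset V (lstep (stk y n)) = D := by
  classical
  set σ : S → List S := fun v => if v ∈ D then s v else stk x n v with hσ
  have hperm : ∀ v, (σ v).Perm (stk x n v) := by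
    intro v
    by_cases h : v ∈ D
    · simpa [hσ, h] using hs v h
    · simp [hσ, h]
  have hin : ∀ v ∈ D, σ v = s v := fun v h => by simp [hσ, h]
  have hout : ∀ v ∉ D, σ v = stk x n v := fun v h => by simp [hσ, h]
  set U := (Finset.range n).image x with hU
  have hxU : ∀ i < n, x i ∈ U := fun i hi => Finset.mem_image_of_mem _ (by simpa using hi)
  have hnil : ∀ v, σ v ≠ [] → stk x n v ≠ [] := by
    intro v h h2
    have := hperm v
    rw [h2] at this
    exact h this.eq_nil
  have hnil' : ∀ v, stk x n v ≠ [] → σ v ≠ [] := by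
    intro v h h2
    have := hperm v
    rw [h2] at this
    exact h this.symm.eq_nil
  have hlead : ∀ v, v ∉ D → ∀ z, Relation.ReflTransGen (lstep (stk x n)) v z →
      Relation.ReflTransGen (lstep σ) v z := by
    intro v hv z hp
    have : Relation.ReflTransGen (lstep σ) v z ∧ z ∉ D := by
      induction hp with
      | refl => exact ⟨.refl, hv⟩
      | tail _ hs ih =>
        refine ⟨ih.1.tail ?_, ?_⟩
        · unfold lstep; rw [hout _ ih.2]; exact hs
        · rw [hD]; exact Dset_step (hD ▸ ih.2) hs
    exact this.1
  have hlead2 : ∀ i ≤ n, x i ∉ D → Relation.ReflTransGen (lstep σ) (x i) (x n) :=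
    fun i hi h => hlead _ h _ (leads_stk hi)
  have hall : ∀ v, σ v ≠ [] → Relation.ReflTransGen (lstep σ) v (x n) := by
    intro v hv
    obtain ⟨i, hi, rfl⟩ := stk_ne_nil.1 (hnil v hv)
    by_cases hvD : x i ∈ D
    · by_contra hc
      set T := D.filter (fun v => (∃ i ≤ n, x i = v) ∧ ¬ Relation.ReflTransGen (lstep σ) v (x n)) with hT
      have hTe : T = ∅ := by
        apply hg T (Finset.filter_subset _ _)
        intro v hv
        rw [hT, Finset.mem_filter] at hv
        obtain ⟨hvD, ⟨j, hj, rfl⟩, hnl⟩ := hv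
        have hjn : j < n := by
          rcases hj.lt_or_eq with h | rfl
          · exact h
          · exact absurd .refl hnl
        have hne : σ (x j) ≠ [] := hnil' _ (stk_ne_nil.2 ⟨j, hjn, rfl⟩)
        have hl : lstep σ (x j) ((σ (x j)).getLast hne) := by
          unfold lstep; exact List.getLast?_eq_some_getLast hne
        set w := (σ (x j)).getLast hne
        have hw : w ∈ stk x n (x j) := (hperm _).mem_iff.1 (List.getLast_mem hne)
        obtain ⟨k, hk, hk1, hk2⟩ := mem_stk.1 hw
        have hwn : ¬ Relation.ReflTransGen (lstep σ) w (x n) := fun h => hnl (.head hl h)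
        refine ⟨w, ?_, ?_⟩
        · rw [hT, Finset.mem_filter]
          refine ⟨?_, ⟨k + 1, hk, hk2⟩, hwn⟩
          by_contra hwD
          rw [← hk2] at hwD hwn
          exact hwn (hlead2 (k + 1) hk hwD)
        · unfold lstep at hl ⊢
          rw [← hin _ hvD]; exact hl
      have : x i ∈ T := by
        rw [hT, Finset.mem_filter]
        exact ⟨hvD, ⟨i, hi.le, rfl⟩, hc⟩
      simp [hTe] at this
    · exact hlead2 i hi.le hvD
  obtain ⟨y, hy0, hyn, hy⟩ := best U n σ (x 0) (x n)
    (by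
      intro u hu
      have : stk x n u = [] := by
        by_contra h
        obtain ⟨i, hi, rfl⟩ := stk_ne_nil.1 h
        exact hu (hxU i hi)
      by_contra h
      exact hnil u h this)
    (by rw [← length_stk_sum x n U hxU]
        exact Finset.sum_congr rfl fun u _ => (hperm u).length_eq)
    (by
      intro v
      rw [(hperm v).length_eq]
      have := balance_stk x n U hxU v
      rw [this]
      congr 1
      exact Finset.sum_congr rfl fun u _ => ((hperm u).count_eq v).symm)
    hall
  refine ⟨y, hy0, hyn, fun v hv => by rw [hy, hin v hv], fun v hv => by rw [hy, hout v hv], ?_⟩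
  rw [hD]
  apply Dset_congr
  intro v hv w
  unfold lstep
  rw [hy, hout v (hD ▸ hv)]
end

section
open Classical in
/-- All rearrangements of a list. -/
noncomputable def lists (r : List S) : Finset (List S) := r.permutations.toFinset

lemma mem_lists {r l : List S} : l ∈ lists r ↔ l.Perm r := by
  classical
  simp [lists]

open Classical in
lemma card_last {r : List S} {w : S} (hw : w ∈ r) :
    ((lists r).filter (fun l => l.getLast? = some w)).card = (lists (r.erase w)).card := by
  rw [← Finset.card_image_of_injective (lists (r.erase w)) (f := fun l => l ++ [w])
    (List.append_left_injective [w])]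
  congr 1
  ext l
  simp only [Finset.mem_filter, Finset.mem_image, mem_lists]
  constructor
  · rintro ⟨h1, h2⟩
    obtain ⟨ys, rfl⟩ := List.getLast?_eq_some_iff.1 h2
    refine ⟨ys, ?_, rfl⟩
    have h3 : (w :: ys).Perm r := (List.perm_append_singleton w ys).symm.trans h1
    exact (List.cons_perm_iff_perm_erase.1 h3).2
  · rintro ⟨ys, h, rfl⟩
    refine ⟨?_, by simp⟩
    exact (List.perm_append_singleton w ys).trans (List.cons_perm_iff_perm_erase.2 ⟨hw, h⟩)

open Classical in
lemma card_lists {r : List S} (hr : r ≠ []) :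
    (lists r).card = ∑ w ∈ r.toFinset, (lists (r.erase w)).card := by
  have h : ∀ l ∈ lists r, l.getLast?.getD (r.head hr) ∈ r.toFinset := by
    intro l hl
    have hp := mem_lists.1 hl
    have hne : l ≠ [] := by rintro rfl; exact hr hp.symm.eq_nil
    rw [List.getLast?_eq_some_getLast hne]
    simp only [Option.getD_some, List.mem_toFinset]
    exact hp.mem_iff.1 (List.getLast_mem hne)
  rw [Finset.card_eq_sum_card_fiberwise h]
  apply Finset.sum_congr rfl
  intro w hw
  rw [← card_last (List.mem_toFinset.1 hw)]
  congr 1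
  apply Finset.filter_congr
  intro l hl
  have hp := mem_lists.1 hl
  have hne : l ≠ [] := by rintro rfl; exact hr hp.symm.eq_nil
  rw [List.getLast?_eq_some_getLast hne]
  simp

open Classical in
lemma card_erase_mul (d : ℕ) : ∀ (r : List S) (w : S), r.length = d → w ∈ r →
    (lists (r.erase w)).card * r.length = r.count w * (lists r).card := by
  induction d with
  | zero => intro r w h hw; rw [List.length_eq_zero_iff] at h; subst h; simp at hw
  | succ d ih =>
    intro r w hl hw
    have hr : r ≠ [] := by rintro rfl; simp at hw
    rw [card_lists hr, hl]
    have e1 : ∑ u ∈ r.toFinset, ((r.erase u).count w + if u = w then 1 else 0) *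
        (lists (r.erase u)).card = r.count w * ∑ u ∈ r.toFinset, (lists (r.erase u)).card := by
      rw [Finset.mul_sum]
      apply Finset.sum_congr rfl
      intro u hu
      congr 1
      have hu' := List.mem_toFinset.1 hu
      split_ifs with h
      · subst h
        rw [List.count_erase_self]
        have := List.count_pos_iff.2 hu'
        omega
      · rw [List.count_erase_of_ne (by simpa using Ne.symm h)]; simp
    rw [← e1]
    simp_rw [add_mul, Finset.sum_add_distrib]
    have e2 : ∑ u ∈ r.toFinset, (if u = w then 1 else 0) * (lists (r.erase u)).card =
        (lists (r.erase w)).card := by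
      simp [Finset.sum_ite_eq', ite_mul, hw]
    rw [e2, mul_add, mul_one]
    congr 1
    have hl' : (r.erase w).length = d := by rw [List.length_erase_of_mem hw, hl]; rfl
    rcases Nat.eq_zero_or_pos d with rfl | hd
    · rw [mul_zero]
      symm
      apply Finset.sum_eq_zero
      intro u hu
      have : (r.erase u).length = 0 := by
        rw [List.length_erase_of_mem (List.mem_toFinset.1 hu), hl]
      rw [List.length_eq_zero_iff] at this
      simp [this]
    · have hne : r.erase w ≠ [] := by intro h; rw [h] at hl'; simp at hl'; omega
      rw [card_lists hne, Finset.sum_mul]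
      have hsub : (r.erase w).toFinset ⊆ r.toFinset := by
        intro u hu
        exact List.mem_toFinset.2 (List.mem_of_mem_erase (List.mem_toFinset.1 hu))
      rw [← Finset.sum_subset hsub]
      · apply Finset.sum_congr rfl
        intro u hu
        have hu1 := List.mem_toFinset.1 hu
        have hu2 := List.mem_toFinset.1 (hsub hu)
        have hlen : (r.erase u).length = d := by rw [List.length_erase_of_mem hu2, hl]; rfl
        have hmem : w ∈ r.erase u := by
          by_cases h : u = w
          · subst h; exact hu1
          · exact (List.mem_erase_of_ne (Ne.symm h)).2 hw
        have := ih (r.erase u) w hlen hmem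
        rw [hlen] at this
        rw [← this, List.erase_comm]
      · intro u hu hu'
        rw [List.mem_toFinset] at hu hu'
        have : u = w := by
          by_contra h
          exact hu' ((List.mem_erase_of_ne h).2 hu)
        subst this
        rw [List.count_eq_zero_of_not_mem hu']; simp

/-- empirical transition matrix of a stack configuration. -/
noncomputable def pst [DecidableEq S] (r : S → List S) (v w : S) : ℝ := (r v).count w / (r v).length

open Classical in
lemma card_filter_last (r : S → List S) (v w : S) :
    (((lists (r v)).filter (fun l => l.getLast? = some w)).card : ℝ) =
      (lists (r v)).card * pst r v w := by
  unfold pst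
  by_cases hw : w ∈ r v
  · rw [card_last hw]
    have h := card_erase_mul _ (r v) w rfl hw
    have hl : ((r v).length : ℝ) ≠ 0 := by
      have : r v ≠ [] := by intro h; simp [h] at hw
      exact_mod_cast (List.length_pos_iff.2 this).ne'
    field_simp
    exact_mod_cast h.trans (mul_comm _ _)
  · rw [List.count_eq_zero_of_not_mem hw]
    have : (lists (r v)).filter (fun l => l.getLast? = some w) = ∅ := by
      apply Finset.filter_false_of_mem
      intro l hl h
      exact hw ((mem_lists.1 hl).mem_iff.1 (List.mem_of_getLast? h))
    simp [this]

open Classical in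
/-- `I - P` restricted to `D`. -/
noncomputable def imat (D : Finset S) (P : S → S → ℝ) : Matrix D D ℝ :=
  fun v w => (if v = w then 1 else 0) - P v w

open Classical in
lemma det_good (D : Finset S) (ℓ : S → Option S) :
    (imat D (fun v w => if ℓ v = some w then 1 else 0)).det =
      if Good D (fun v w => ℓ v = some w) then 1 else 0 := by
  split_ifs with h
  · have wf : WellFounded (fun w v : D => ℓ v = some (w : S)) := by
      rw [WellFounded.wellFounded_iff_has_min]
      intro T hT
      by_contra hc
      push Not at hc
      have h1 := h ((Finset.univ.filter (· ∈ T)).image Subtype.val) (by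
          intro v hv
          simp only [Finset.mem_image] at hv
          obtain ⟨a, _, rfl⟩ := hv
          exact a.2) (by
          intro v hv
          simp only [Finset.mem_image, Finset.mem_filter, Finset.mem_univ, true_and] at hv ⊢
          obtain ⟨a, ha, rfl⟩ := hv
          obtain ⟨b, hb, hab⟩ := hc a ha
          exact ⟨b, ⟨b, hb, rfl⟩, hab⟩)
      obtain ⟨a, ha⟩ := hT
      have : (a : S) ∈ (Finset.univ.filter (· ∈ T)).image Subtype.val := by
        simp [ha]
      rw [h1] at this
      simp at this
    have iwf : IsWellFounded D (fun w v : D => ℓ v = some (w : S)) := ⟨wf⟩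
    let rk : D → Ordinal := IsWellFounded.rank (fun w v : D => ℓ v = some (w : S))
    have rk_lt : ∀ {a b : D}, ℓ b = some (a : S) → rk a < rk b := fun {a b} h =>
      IsWellFounded.rank_lt_of_rel (r := fun w v : D => ℓ v = some (w : S)) h
    have bt : (imat D (fun v w => if ℓ v = some w then 1 else 0)).BlockTriangular
        (fun v => OrderDual.toDual (rk v)) := by
      intro i j hij
      have hlt : rk i < rk j := hij
      have hne : i ≠ j := by rintro rfl; exact lt_irrefl _ hlt
      have : ¬ ℓ i = some (j : S) := fun hs => by
        have h2 : rk j < rk i := rk_lt hs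
        exact lt_asymm hlt h2
      simp [imat, hne, this]
    rw [bt.det]
    apply Finset.prod_eq_one
    intro a _
    rw [← Matrix.det_one (n := {i // OrderDual.toDual (rk i) = a})]
    congr 1
    ext i j
    have : ¬ ℓ i.1 = some (j.1 : S) := fun hs => by
      have h2 : rk j.1 < rk i.1 := rk_lt hs
      have h3 : rk i.1 = rk j.1 := OrderDual.toDual.injective (i.2.trans j.2.symm)
      exact absurd h3 h2.ne'
    by_cases hij : i = j
    · subst hij
      simp [Matrix.toSquareBlock, Matrix.toSquareBlockProp, imat, this]
    · have hij' : i.1 ≠ j.1 := fun h => hij (Subtype.ext h)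
      simp [Matrix.toSquareBlock, Matrix.toSquareBlockProp, imat, this, hij, hij']
  · unfold Good at h
    push Not at h
    obtain ⟨T, hT, hcl, hne⟩ := h
    set Q : S → Prop := fun v => ∃ t ∈ T, Relation.ReflTransGen (fun a b => ℓ a = some b ∧ b ∈ D) v t
    have hQ1 : ∀ v, Q v → ∃ w ∈ D, Q w ∧ ℓ v = some w := by
      rintro v ⟨t, ht, hp⟩
      rcases Relation.ReflTransGen.cases_head hp with rfl | ⟨w, hw, hp'⟩
      · obtain ⟨w, hw, h⟩ := hcl v ht
        exact ⟨w, hT hw, ⟨w, hw, .refl⟩, h⟩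
      · exact ⟨w, hw.2, ⟨t, ht, hp'⟩, hw.1⟩
    have hQ2 : ∀ v w, ℓ v = some w → w ∈ D → Q w → Q v := by
      rintro v w h hw ⟨t, ht, hp⟩
      exact ⟨t, ht, .head ⟨h, hw⟩ hp⟩
    apply Matrix.exists_mulVec_eq_zero_iff.1
    refine ⟨fun v : D => if Q v then 1 else 0, ?_, ?_⟩
    · obtain ⟨t, ht⟩ := hne
      intro h0
      have := congrFun h0 ⟨t, hT ht⟩
      have hq : Q t := ⟨t, ht, .refl⟩
      simp [hq] at this
    · ext v
      simp only [Matrix.mulVec, dotProduct, imat, sub_mul, Finset.sum_sub_distrib, Pi.zero_apply]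
      by_cases hq : Q v
      · obtain ⟨w, hw, hqw, hl⟩ := hQ1 v hq
        rw [Finset.sum_eq_single v, Finset.sum_eq_single (⟨w, hw⟩ : D)]
        · simp [hq, hqw, hl]
        · intro b _ hb
          have : ¬ ℓ v = some (b : S) := by
            rw [hl]; intro h; exact hb (Subtype.ext (Option.some.inj h).symm)
          simp [this]
        · simp
        · intro b _ hb; simp [Ne.symm hb]
        · simp
      · rw [Finset.sum_eq_zero, Finset.sum_eq_zero]
        · simp
        · intro b _
          by_cases h : ℓ v = some (b : S)
          · have : ¬ Q b := fun h2 => hq (hQ2 _ _ h b.2 h2)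
            simp [this]
          · simp [h]
        · intro b _
          by_cases h : v = b
          · subst h; simp [hq]
          · simp [h]

open Classical in
/-- extend a stack configuration by empty stacks -/
noncomputable def extD {D : Finset S} (s : D → List S) (v : S) : List S :=
  if h : v ∈ D then s ⟨v, h⟩ else []

lemma extD_mem {D : Finset S} (s : D → List S) (v : D) : extD s v = s v := by
  simp [extD]

open Classical in
lemma count_good (D : Finset S) (Λ : S → Finset (List S)) (P : S → S → ℝ)
    (hP : ∀ v ∈ D, ∀ w ∈ D, (((Λ v).filter (fun l => l.getLast? = some w)).card : ℝ) =
      (Λ v).card * P v w) :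
    ((((Fintype.piFinset fun v : D => Λ v)).filter (fun s => Good D (lstep (extD s)))).card : ℝ) =
      (∏ v ∈ D, ((Λ v).card : ℝ)) * (imat D P).det := by
  rw [Finset.card_filter]
  push_cast
  have h1 : ∀ s : D → List S, (if Good D (lstep (extD s)) then (1:ℝ) else 0) =
      Matrix.detRowAlternating (R := ℝ) (fun v w : D => (if v = w then (1:ℝ) else 0) -
        if (s v).getLast? = some (w : S) then 1 else 0) := by
    intro s
    have := det_good D (fun v => (extD s v).getLast?)
    unfold lstep
    rw [← this]
    show Matrix.det _ = Matrix.det _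
    congr 1
    ext v w
    simp [imat, extD_mem]
  simp_rw [h1]
  have h2 := MultilinearMap.map_sum_finset
    (Matrix.detRowAlternating (R := ℝ) (n := D)).toMultilinearMap
    (A := fun v : D => Λ v)
    (g := fun (v : D) (l : List S) (w : D) => (if v = w then (1:ℝ) else 0) -
        if l.getLast? = some (w : S) then 1 else 0)
  refine Eq.trans h2.symm ?_
  show Matrix.det _ = _
  rw [← Finset.prod_coe_sort, ← Matrix.det_mul_column]
  congr 1
  ext v w
  simp only [Finset.sum_apply, Finset.sum_sub_distrib, Matrix.of_apply, imat, mul_sub]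
  rw [← hP v v.2 w w.2]
  simp
end

section
open Classical in
lemma swap_tsum {P : Type} (cls : P → Finset P) (hself : ∀ p, p ∈ cls p)
    (hcls : ∀ p q, q ∈ cls p → cls q = cls p) (w : P → ℝ≥0∞) (hw : ∀ p q, q ∈ cls p → w q = w p)
    (C : P → Prop) :
    ∑' p, (if C p then w p else 0) =
      ∑' q, w q * ((((cls q).filter C).card : ℝ≥0∞) / ((cls q).card : ℝ≥0∞)) := by
  have hsymm : ∀ p q, q ∈ cls p ↔ p ∈ cls q := fun p q =>
    ⟨fun h => by rw [hcls p q h]; exact hself p, fun h => by rw [hcls q p h]; exact hself q⟩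
  have e1 : ∀ q, w q * ((((cls q).filter C).card : ℝ≥0∞) / ((cls q).card : ℝ≥0∞)) =
      ∑' p, if p ∈ cls q ∧ C p then w p / ((cls p).card : ℝ≥0∞) else 0 := by
    intro q
    rw [tsum_eq_sum (s := (cls q).filter C)]
    · rw [Finset.sum_congr rfl (g := fun _ => w q / ((cls q).card : ℝ≥0∞))]
      · rw [Finset.sum_const, nsmul_eq_mul]
        simp only [div_eq_mul_inv]
        ring
      · intro p hp
        have hp' := Finset.mem_filter.1 hp
        rw [if_pos hp', hw q p hp'.1, hcls q p hp'.1]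
    · intro p hp
      rw [Finset.mem_filter] at hp
      rw [if_neg hp]
  simp_rw [e1]
  rw [ENNReal.tsum_comm]
  apply tsum_congr
  intro p
  by_cases hC : C p
  · simp only [hC, and_true, if_true]
    rw [tsum_eq_sum (s := cls p)]
    · rw [Finset.sum_congr rfl (g := fun _ => w p / ((cls p).card : ℝ≥0∞))]
      · rw [Finset.sum_const, nsmul_eq_mul, ENNReal.mul_div_cancel]
        · exact_mod_cast (Finset.card_pos.2 ⟨p, hself p⟩).ne'
        · exact ENNReal.natCast_ne_top _
      · intro q hq
        rw [if_pos ((hsymm _ _).1 hq)]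
    · intro q hq
      rw [if_neg (fun h => hq ((hsymm _ _).1 h))]
  · simp [hC]

/-- prefix extended to a path -/
def pext {n : ℕ} (p : Fin (n + 1) → S) (i : ℕ) : S := p ⟨min i n, by omega⟩

/-- prefix of a path -/
def pres (n : ℕ) (x : ℕ → S) (i : Fin (n + 1)) : S := x i

lemma pext_pres {n : ℕ} (x : ℕ → S) {i : ℕ} (hi : i ≤ n) : pext (pres n x) i = x i := by
  simp [pext, pres, hi]

lemma pres_pext {n : ℕ} (p : Fin (n + 1) → S) : pres n (pext p) = p := by
  ext i
  have : (i : ℕ) ≤ n := by omega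
  simp [pext, pres, this]

/-- The equivalence of paths used for averaging. -/
def Rel (V : Finset S) (n : ℕ) (x y : ℕ → S) : Prop :=
  y 0 = x 0 ∧ y n = x n ∧ Dset V (lstep (stk y n)) = Dset V (lstep (stk x n)) ∧
    (∀ v ∉ Dset V (lstep (stk x n)), stk y n v = stk x n v) ∧
    ∀ v ∈ Dset V (lstep (stk x n)), (stk y n v).Perm (stk x n v)

lemma Rel.refl (V : Finset S) (n : ℕ) (x : ℕ → S) : Rel V n x x :=
  ⟨rfl, rfl, rfl, fun _ _ => rfl, fun _ _ => .refl _⟩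

lemma Rel.symm {V : Finset S} {n : ℕ} {x y : ℕ → S} (h : Rel V n x y) : Rel V n y x := by
  obtain ⟨h1, h2, h3, h4, h5⟩ := h
  refine ⟨h1.symm, h2.symm, h3.symm, ?_, ?_⟩
  · rw [h3]; exact fun v hv => (h4 v hv).symm
  · rw [h3]; exact fun v hv => (h5 v hv).symm

lemma Rel.trans {V : Finset S} {n : ℕ} {x y z : ℕ → S} (h : Rel V n x y) (h' : Rel V n y z) :
    Rel V n x z := by
  obtain ⟨h1, h2, h3, h4, h5⟩ := h
  obtain ⟨g1, g2, g3, g4, g5⟩ := h'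
  rw [h3] at g3 g4 g5
  exact ⟨g1.trans h1, g2.trans h2, g3, fun v hv => (g4 v hv).trans (h4 v hv),
    fun v hv => (g5 v hv).trans (h5 v hv)⟩

lemma Rel.perm {V : Finset S} {n : ℕ} {x y : ℕ → S} (h : Rel V n x y) (v : S) :
    (stk y n v).Perm (stk x n v) := by
  by_cases hv : v ∈ Dset V (lstep (stk x n))
  · exact h.2.2.2.2 v hv
  · rw [h.2.2.2.1 v hv]

open Classical in
/-- class of a prefix -/
noncomputable def cls (V : Finset S) (n : ℕ) (p : Fin (n + 1) → S) : Finset (Fin (n + 1) → S) :=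
  (Fintype.piFinset fun _ => Finset.univ.image p).filter (fun q => Rel V n (pext p) (pext q))

lemma mem_cls {V : Finset S} {n : ℕ} {p q : Fin (n + 1) → S} :
    q ∈ cls V n p ↔ Rel V n (pext p) (pext q) := by
  classical
  unfold cls
  rw [Finset.mem_filter, and_iff_right_iff_imp]
  intro h
  rw [Fintype.mem_piFinset]
  intro i
  rw [Finset.mem_image]
  have hq : q i = pext q i := by
    conv_lhs => rw [← pres_pext q]
    rfl
  have hi : (i : ℕ) ≤ n := by omega
  rcases hi.lt_or_eq with hi | hi
  · have h1 : stk (pext q) n (q i) ≠ [] := stk_ne_nil.2 ⟨i, hi, hq.symm⟩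
    have h2 : stk (pext p) n (q i) ≠ [] := by
      intro h3
      have := h.perm (q i)
      rw [h3] at this
      exact h1 this.eq_nil
    obtain ⟨j, hj, hj'⟩ := stk_ne_nil.1 h2
    exact ⟨_, Finset.mem_univ _, hj'⟩
  · rw [hq, hi, h.2.1]
    exact ⟨_, Finset.mem_univ _, rfl⟩

lemma Good.congr {D : Finset S} {ℓ ℓ' : S → S → Prop} (h : ∀ v ∈ D, ∀ w, ℓ v w ↔ ℓ' v w)
    (hg : Good D ℓ) : Good D ℓ' := by
  intro T hT hcl
  apply hg T hT
  intro v hv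
  obtain ⟨w, hw, hl⟩ := hcl v hv
  exact ⟨w, hw, (h v (hT hv) w).2 hl⟩

open Classical in
lemma card_cls {V : Finset S} {n : ℕ} {p : Fin (n + 1) → S} (hn : pext p n ∉ V) {D : Finset S}
    (hD : D = Dset V (lstep (stk (pext p) n))) (Λ : S → Finset (List S))
    (hΛ : ∀ v ∈ D, Λ v ⊆ lists (stk (pext p) n v)) :
    ((cls V n p).filter (fun q => ∀ v ∈ D, stk (pext q) n v ∈ Λ v)).card =
      (((Fintype.piFinset fun v : D => Λ v)).filter (fun s => Good D (lstep (extD s)))).card := by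
  refine Finset.card_bij (fun q _ => (fun (v : D) => stk (pext q) n v)) ?_ ?_ ?_
  · intro q hq
    rw [Finset.mem_filter, mem_cls] at hq
    rw [Finset.mem_filter, Fintype.mem_piFinset]
    refine ⟨fun v => hq.2 v v.2, ?_⟩
    have hn' : pext q n ∉ V := by rw [hq.1.2.1]; exact hn
    refine (good_stk hn' (D := D) (hD ▸ Dset_subset _ _)).congr ?_
    intro v hv w
    unfold lstep
    rw [extD_mem (fun v : D => stk (pext q) n v) ⟨v, hv⟩]
  · intro q hq q' hq' he
    rw [Finset.mem_filter, mem_cls] at hq hq'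
    have h1 : ∀ v, stk (pext q) n v = stk (pext q') n v := by
      intro v
      by_cases hv : v ∈ D
      · exact congrFun he ⟨v, hv⟩
      · rw [hD] at hv
        rw [hq.1.2.2.2.1 v hv, hq'.1.2.2.2.1 v hv]
    have h2 := eq_of_stk_eq (hq.1.1.trans hq'.1.1.symm) h1
    rw [← pres_pext q, ← pres_pext q']
    ext i
    exact h2 i (by omega)
  · intro s hs
    rw [Finset.mem_filter, Fintype.mem_piFinset] at hs
    have hperm : ∀ v ∈ D, (extD s v).Perm (stk (pext p) n v) := by
      intro v hv
      rw [extD_mem s ⟨v, hv⟩]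
      exact mem_lists.1 (hΛ v hv (hs.1 ⟨v, hv⟩))
    obtain ⟨y, h0, h1, h2, h3, h4⟩ := restack hn hD (extD s) hperm hs.2
    have hst : ∀ v, stk (pext (pres n y)) n v = stk y n v :=
      fun v => stk_congr (fun i hi => pext_pres y hi) v
    have hst' : stk (pext (pres n y)) n = stk y n := funext hst
    refine ⟨pres n y, ?_, ?_⟩
    · rw [Finset.mem_filter, mem_cls]
      refine ⟨⟨?_, ?_, ?_, ?_, ?_⟩, ?_⟩
      · rw [pext_pres y (Nat.zero_le n), h0]
      · rw [pext_pres y le_rfl, h1]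
      · rw [hst', h4, hD]
      · rw [← hD, hst']; exact h3
      · rw [← hD, hst']; intro v hv; rw [h2 v hv]; exact hperm v hv
      · intro v hv
        rw [hst', h2 v hv, extD_mem s ⟨v, hv⟩]
        exact hs.1 ⟨v, hv⟩
    · ext1 v
      rw [hst', h2 v v.2, extD_mem]

open Classical in
/-- matrix with forced rows -/
noncomputable def PF (K : Finset S) (t : S → List S) (P : S → S → ℝ) (v w : S) : ℝ :=
  if v ∈ K then (if (t v).getLast? = some w then 1 else 0) else P v w

open Classical in
/-- the ratio -/
noncomputable def rat (K : Finset S) (t : S → List S) (P : S → S → ℝ) (D : Finset S) : ℝ :=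
  (∏ v ∈ K, ((lists (t v)).card : ℝ))⁻¹ * ((imat D (PF K t P)).det / (imat D P).det)

open Classical in
/-- emptirical density at level `V`, `n`. -/
noncomputable def alp (K : Finset S) (t : S → List S) (V : Finset S) (n : ℕ) (x : ℕ → S) : ℝ≥0∞ :=
  if x n ∉ V ∧ K ⊆ Dset V (lstep (stk x n)) ∧ ∀ v ∈ K, (stk x n v).Perm (t v) then
    ENNReal.ofReal (rat K t (pst (stk x n)) (Dset V (lstep (stk x n)))) else 0

/-- the event at level `V`, `n`. -/
def Bet (K : Finset S) (t : S → List S) (V : Finset S) (n : ℕ) (x : ℕ → S) : Prop :=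
  x n ∉ V ∧ K ⊆ Dset V (lstep (stk x n)) ∧ ∀ v ∈ K, stk x n v = t v

lemma lists_card_pos (l : List S) : 0 < (lists l).card :=
  Finset.card_pos.2 ⟨l, mem_lists.2 (.refl _)⟩

open Classical in
lemma ratio_eq (K : Finset S) (t : S → List S) (V : Finset S) (n : ℕ) (p : Fin (n + 1) → S) :
    ((((cls V n p).filter (fun q => Bet K t V n (pext q))).card : ℝ≥0∞) / ((cls V n p).card : ℝ≥0∞)) =
      alp K t V n (pext p) := by
  set x := pext p with hx
  set D := Dset V (lstep (stk x n)) with hD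
  unfold alp
  split_ifs with h
  · obtain ⟨hn, hK, ht⟩ := h
    have c1 : ((cls V n p).card : ℝ) =
        (∏ v ∈ D, ((lists (stk x n v)).card : ℝ)) * (imat D (pst (stk x n))).det := by
      rw [← count_good D (fun v => lists (stk x n v)) (pst (stk x n))
        (fun v _ w _ => card_filter_last _ v w),
        ← card_cls hn hD (fun v => lists (stk x n v)) (fun v _ => Finset.Subset.refl _)]
      congr 2
      symm
      apply Finset.filter_true_of_mem
      intro q hq v _
      exact mem_lists.2 ((mem_cls.1 hq).perm v)
    set Λ : S → Finset (List S) := fun v => if v ∈ K then {t v} else lists (stk x n v) with hΛ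
    have c2 : (((cls V n p).filter (fun q => Bet K t V n (pext q))).card : ℝ) =
        (∏ v ∈ D, ((Λ v).card : ℝ)) * (imat D (PF K t (pst (stk x n)))).det := by
      rw [← count_good D Λ, ← card_cls hn hD Λ]
      · congr 2
        apply Finset.filter_congr
        intro q hq
        have hq := mem_cls.1 hq
        unfold Bet
        rw [hq.2.1, hq.2.2.1]
        constructor
        · rintro ⟨_, _, h3⟩ v hv
          simp only [hΛ]
          split_ifs with hvK
          · simp [h3 v hvK]
          · exact mem_lists.2 (hq.perm v)
        · intro h3
          refine ⟨hn, hK, fun v hv => ?_⟩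
          have := h3 v (hK hv)
          simpa [hΛ, hv] using this
      · intro v _
        simp only [hΛ]
        split_ifs with hvK
        · rw [Finset.singleton_subset_iff]; exact mem_lists.2 (ht v hvK).symm
        · exact Finset.Subset.refl _
      · intro v _ w _
        by_cases hvK : v ∈ K
        · simp only [hΛ, PF, hvK, if_true, Finset.filter_singleton]
          split_ifs <;> simp
        · simp only [hΛ, PF, hvK, if_false]
          exact card_filter_last _ v w
    have hpos : 0 < (cls V n p).card := Finset.card_pos.2 ⟨p, mem_cls.2 (Rel.refl _ _ _)⟩
    have hpos' : (0 : ℝ) < (cls V n p).card := by exact_mod_cast hpos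
    have key : rat K t (pst (stk x n)) D =
        (((cls V n p).filter (fun q => Bet K t V n (pext q))).card : ℝ) / ((cls V n p).card : ℝ) := by
      rw [c1, c2]
      unfold rat
      have e1 : ∏ v ∈ D, ((lists (stk x n v)).card : ℝ) =
          (∏ v ∈ K, ((lists (t v)).card : ℝ)) * ∏ v ∈ D, ((Λ v).card : ℝ) := by
        rw [← Finset.prod_sdiff hK, ← Finset.prod_sdiff hK, mul_comm, mul_left_comm]
        have a1 : ∏ v ∈ K, ((lists (stk x n v)).card : ℝ) = ∏ v ∈ K, ((lists (t v)).card : ℝ) := by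
          apply Finset.prod_congr rfl
          intro v hv
          congr 2
          ext l
          rw [mem_lists, mem_lists]
          exact ⟨fun h => h.trans (ht v hv), fun h => h.trans (ht v hv).symm⟩
        have a2 : ∏ v ∈ K, ((Λ v).card : ℝ) = 1 := by
          apply Finset.prod_eq_one
          intro v hv
          simp [hΛ, hv]
        have a3 : ∏ v ∈ D \ K, ((Λ v).card : ℝ) = ∏ v ∈ D \ K, ((lists (stk x n v)).card : ℝ) := by
          apply Finset.prod_congr rfl
          intro v hv
          simp [hΛ, (Finset.mem_sdiff.1 hv).2]
        rw [a1, a2, a3]; ring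
      rw [e1]
      have n1 : (∏ v ∈ K, ((lists (t v)).card : ℝ)) ≠ 0 :=
        Finset.prod_ne_zero_iff.2 fun v _ => by exact_mod_cast (lists_card_pos _).ne'
      have n2 : (∏ v ∈ D, ((lists (stk x n v)).card : ℝ)) ≠ 0 :=
        Finset.prod_ne_zero_iff.2 fun v _ => by exact_mod_cast (lists_card_pos _).ne'
      have n3 : ∏ v ∈ D, ((Λ v).card : ℝ) ≠ 0 := by
        rw [e1] at n2; exact right_ne_zero_of_mul n2
      have n4 : (imat D (pst (stk x n))).det ≠ 0 := by
        rw [c1] at hpos'; exact right_ne_zero_of_mul hpos'.ne'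
      field_simp
    rw [key, ENNReal.ofReal_div_of_pos hpos']
    simp
  · have : (cls V n p).filter (fun q => Bet K t V n (pext q)) = ∅ := by
      apply Finset.filter_false_of_mem
      intro q hq hb
      have hq := mem_cls.1 hq
      apply h
      unfold Bet at hb
      rw [hq.2.1, hq.2.2.1] at hb
      refine ⟨hb.1, hb.2.1, fun v hv => ?_⟩
      rw [← hb.2.2 v hv]
      exact (hq.perm v).symm
    simp [this]

lemma alp_pext (K : Finset S) (t : S → List S) (V : Finset S) (n : ℕ) (x : ℕ → S) :
    alp K t V n (pext (pres n x)) = alp K t V n x := by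
  have : stk (pext (pres n x)) n = stk x n :=
    funext fun v => stk_congr (fun i hi => pext_pres x hi) v
  unfold alp
  rw [this, pext_pres x le_rfl]

lemma bet_pext (K : Finset S) (t : S → List S) (V : Finset S) (n : ℕ) (x : ℕ → S) :
    Bet K t V n (pext (pres n x)) ↔ Bet K t V n x := by
  have : stk (pext (pres n x)) n = stk x n :=
    funext fun v => stk_congr (fun i hi => pext_pres x hi) v
  unfold Bet
  rw [this, pext_pres x le_rfl]

lemma alp_le_one (K : Finset S) (t : S → List S) (V : Finset S) (n : ℕ) (x : ℕ → S) :
    alp K t V n x ≤ 1 := by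
  classical
  rw [← alp_pext, ← ratio_eq]
  apply ENNReal.div_le_of_le_mul
  rw [one_mul]
  exact_mod_cast Finset.card_le_card (Finset.filter_subset _ _)

variable [Countable S] [MeasurableSpace S] [DiscreteMeasurableSpace S]

lemma measurable_pres (n : ℕ) : Measurable (pres (S := S) n) :=
  measurable_pi_lambda _ fun _ => measurable_pi_apply _

lemma measurable_prefix {β : Type} [MeasurableSpace β] {n : ℕ} {f : (ℕ → S) → β}
    (h : ∀ x, f (pext (pres n x)) = f x) : Measurable f := by
  have : f = (fun p => f (pext p)) ∘ pres n := by ext x; exact (h x).symm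
  rw [this]
  exact (Measurable.of_discrete).comp (measurable_pres n)

lemma lintegral_prefix {n : ℕ} {f : (ℕ → S) → ℝ≥0∞} (μ : Measure (ℕ → S)) {H : Set (ℕ → S)}
    (h : ∀ x, f (pext (pres n x)) = f x) :
    ∫⁻ x in H, f x ∂μ = ∑' p, f (pext p) * μ.restrict H (pres n ⁻¹' {p}) := by
  have e : ∫⁻ x in H, f x ∂μ = ∫⁻ p, f (pext p) ∂((μ.restrict H).map (pres n)) := by
    rw [lintegral_map Measurable.of_discrete (measurable_pres n)]
    exact lintegral_congr fun x => (h x).symm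
  rw [e, lintegral_countable']
  apply tsum_congr
  intro p
  rw [Measure.map_apply (measurable_pres n) (measurableSet_singleton p)]

open Classical in
/-- The identity at finite level. -/
lemma level_identity (μ : Measure (ℕ → S)) {H : Set (ℕ → S)} (K : Finset S) (t : S → List S)
    (V : Finset S) (n : ℕ)
    (hinv : ∀ p q : Fin (n + 1) → S, Rel V n (pext p) (pext q) →
      μ.restrict H (pres n ⁻¹' {q}) = μ.restrict H (pres n ⁻¹' {p})) :
    ∫⁻ x in H, (if Bet K t V n x then 1 else 0) ∂μ = ∫⁻ x in H, alp K t V n x ∂μ := by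
  rw [lintegral_prefix (n := n) μ (fun x => by simp only [bet_pext]),
    lintegral_prefix (n := n) μ (alp_pext K t V n)]
  have := swap_tsum (cls V n) (fun p => mem_cls.2 (Rel.refl _ _ _))
    (fun p q hq => by
      ext r
      have hq := mem_cls.1 hq
      rw [mem_cls, mem_cls]
      exact ⟨fun h => hq.trans h, fun h => hq.symm.trans h⟩)
    (fun p => μ.restrict H (pres n ⁻¹' {p})) (fun p q hq => hinv p q (mem_cls.1 hq))
    (fun q => Bet K t V n (pext q))
  refine Eq.trans ?_ (this.trans ?_)
  · apply tsum_congr; intro p; split_ifs <;> simp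
  · apply tsum_congr; intro p; rw [ratio_eq, mul_comm]
end

section
lemma finEquiv_of_tail {x y : ℕ → S} {n m : ℕ} (hnm : n ≤ m) (h0 : x 0 = y 0)
    (hp : ∀ v, (stk x n v).Perm (stk y n v)) (ht : ∀ i, n ≤ i → x i = y i) : FinEquiv x y m := by
  rw [finEquiv_iff]
  refine ⟨h0, fun v => ?_⟩
  obtain ⟨k, rfl⟩ := Nat.exists_eq_add_of_le hnm
  rw [stk_add, stk_add]
  have : (fun i => x (n + i)) = fun i => y (n + i) := funext fun i => ht _ (by omega)
  rw [this]
  exact (hp v).append_right _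

lemma pres_preimage (n : ℕ) (x : ℕ → S) : pres n ⁻¹' {pres n x} = {ω | ∀ i ≤ n, ω i = x i} := by
  ext ω
  simp only [mem_preimage, mem_singleton_iff, mem_ofPred_eq]
  constructor
  · intro h i hi; exact congrFun h ⟨i, by omega⟩
  · intro h; ext i; exact h i (by omega)

/-- replace the prefix -/
def glue {n : ℕ} (q : Fin (n + 1) → S) (x : ℕ → S) (i : ℕ) : S := if i ≤ n then pext q i else x i

section
variable [Countable S] [MeasurableSpace S] [DiscreteMeasurableSpace S]

lemma measure_ext_cyl (ν₁ ν₂ : Measure (ℕ → S)) [IsFiniteMeasure ν₁] (n : ℕ)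
    (h : ∀ m, n ≤ m → ∀ r : Fin (m + 1) → S, ν₁ (pres m ⁻¹' {r}) = ν₂ (pres m ⁻¹' {r})) :
    ν₁ = ν₂ := by
  have hmap : ∀ m, n ≤ m → ν₁.map (pres m) = ν₂.map (pres m) := by
    intro m hm
    apply Measure.ext_of_singleton
    intro r
    rw [Measure.map_apply (measurable_pres m) (measurableSet_singleton r),
      Measure.map_apply (measurable_pres m) (measurableSet_singleton r), h m hm]
  have hpre : ∀ m, n ≤ m → ∀ A : Set (Fin (m + 1) → S), ν₁ (pres m ⁻¹' A) = ν₂ (pres m ⁻¹' A) := by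
    intro m hm A
    have hA : MeasurableSet A := MeasurableSet.of_discrete
    rw [← Measure.map_apply (measurable_pres m) hA, ← Measure.map_apply (measurable_pres m) hA,
      hmap m hm]
  refine ext_of_generate_finite (measurableCylinders (fun _ : ℕ => S))
    (generateFrom_measurableCylinders (α := fun _ : ℕ => S)).symm isPiSystem_measurableCylinders ?_ ?_
  · intro s hs
    obtain ⟨I, T, hT, rfl⟩ := (mem_measurableCylinders _).1 hs
    set m := max n (I.sup id) with hm
    have : cylinder I T = pres m ⁻¹' {p | I.restrict (pext p) ∈ T} := by
      ext x
      simp only [mem_cylinder, mem_preimage, mem_ofPred_eq]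
      have : I.restrict (pext (pres m x)) = I.restrict x := by
        ext i
        have : (i : ℕ) ≤ m := le_max_of_le_right (Finset.le_sup (f := id) i.2)
        simp [Finset.restrict, pext_pres x this]
      rw [this]
    rw [this]
    exact hpre m (le_max_left _ _) _
  · have := hpre n le_rfl univ
    simpa using this

lemma restrict_prefix (μ : Measure (ℕ → S)) [IsFiniteMeasure μ] (hPE : PartiallyExchangeable μ)
    {n : ℕ} {p q : Fin (n + 1) → S} (h0 : pext q 0 = pext p 0) (hn : pext q n = pext p n)
    (hp : ∀ v, (stk (pext q) n v).Perm (stk (pext p) n v)) {H : Set (ℕ → S)} (hH : MeasurableSet H)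
    (hinv : ∀ x y, InfEquiv x y → (x ∈ H ↔ y ∈ H)) :
    μ.restrict H (pres n ⁻¹' {q}) = μ.restrict H (pres n ⁻¹' {p}) := by
  have hms : ∀ (m : ℕ) (r : Fin (m + 1) → S), MeasurableSet (pres m ⁻¹' {r}) :=
    fun m r => measurable_pres m (measurableSet_singleton r)
  have hgm : ∀ r : Fin (n + 1) → S, Measurable (glue r) := by
    intro r
    apply measurable_pi_lambda
    intro i
    unfold glue
    split_ifs
    · exact measurable_const
    · exact measurable_pi_apply i
  have hstk : ∀ (a : Fin (n + 1) → S) (x : ℕ → S) v, stk (glue a x) n v = stk (pext a) n v :=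
    fun a x v => stk_congr (fun i hi => by simp [glue, hi]) v
  have hpresglue : ∀ (a : Fin (n + 1) → S) (x : ℕ → S), pres n (glue a x) = a := by
    intro a x
    rw [← pres_pext a]
    ext i
    have : (i : ℕ) ≤ n := by omega
    simp [pres, glue, this, pext_pres]
  have hfix : ∀ (a : Fin (n + 1) → S) (x : ℕ → S), pres n x = a → glue a x = x := by
    intro a x ha
    ext i
    subst ha
    unfold glue
    split_ifs with h
    · exact pext_pres x h
    · rfl
  have hfe : ∀ (x : ℕ → S) m, n ≤ m → FinEquiv (glue q x) (glue p x) m := by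
    intro x m hm
    apply finEquiv_of_tail hm
    · simp [glue, h0]
    · intro v; rw [hstk, hstk]; exact hp v
    · intro i hi
      rcases hi.eq_or_lt with rfl | hi
      · simp [glue, hn]
      · simp [glue, not_le.2 hi]
  have htl : ∀ (x : ℕ → S) i, n ≤ i → glue q x i = glue p x i := by
    intro x i hi
    rcases hi.eq_or_lt with rfl | hi
    · simp [glue, hn]
    · simp [glue, not_le.2 hi]
  have hmeas : (μ.restrict (pres n ⁻¹' {p})).map (glue q) = μ.restrict (pres n ⁻¹' {q}) := by
    have : IsFiniteMeasure ((μ.restrict (pres n ⁻¹' {p})).map (glue q)) := inferInstance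
    apply measure_ext_cyl _ _ n
    intro m hm r
    rw [Measure.map_apply (hgm q) (hms m r), Measure.restrict_apply (hgm q (hms m r)),
      Measure.restrict_apply (hms m r)]
    have hr : ∀ x, pres m x = r → ∀ i ≤ m, x i = pext r i := by
      intro x hx i hi; subst hx; exact (pext_pres x hi).symm
    have hr' : ∀ x : ℕ → S, (∀ i ≤ m, x i = pext r i) → pres m x = r := by
      intro x hx
      rw [← pres_pext r]
      ext i
      exact hx i (by omega)
    by_cases hc : pres n (pext r) = q
    · have e1 : pres m ⁻¹' {r} ∩ pres n ⁻¹' {q} = {ω | ∀ i ≤ m, ω i = glue q (pext r) i} := by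
        rw [hfix q _ hc]
        ext ω
        simp only [mem_inter_iff, mem_preimage, mem_singleton_iff, mem_ofPred_eq]
        constructor
        · rintro ⟨h, _⟩; exact hr ω h
        · intro h
          refine ⟨hr' ω h, ?_⟩
          rw [← hc]
          ext i
          exact h i (by omega)
      have e2 : glue q ⁻¹' (pres m ⁻¹' {r}) ∩ pres n ⁻¹' {p} =
          {ω | ∀ i ≤ m, ω i = glue p (pext r) i} := by
        ext ω
        simp only [mem_inter_iff, mem_preimage, mem_singleton_iff, mem_ofPred_eq]
        constructor
        · rintro ⟨h, h2⟩ i hi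
          have h3 := hr _ h i hi
          rw [← hfix p ω h2]
          unfold glue at h3 ⊢
          split_ifs at h3 ⊢ with hin
          · rfl
          · exact h3
        · intro h
          have h2 : pres n ω = p := by
            rw [← hpresglue p (pext r)]
            ext i
            exact h i (by omega)
          refine ⟨hr' _ ?_, h2⟩
          intro i hi
          have h3 := h i hi
          rw [← hfix q (pext r) hc]
          unfold glue at h3 ⊢
          split_ifs at h3 ⊢ with hin
          · rfl
          · exact h3
      rw [e1, e2]
      exact (hPE m _ _ (hfe (pext r) m hm)).symm
    · have e1 : pres m ⁻¹' {r} ∩ pres n ⁻¹' {q} = ∅ := by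
        ext ω
        simp only [mem_inter_iff, mem_preimage, mem_singleton_iff, mem_empty_iff_false, iff_false]
        rintro ⟨h, h2⟩
        apply hc
        rw [← h2]
        ext i
        exact (hr ω h i (by omega)).symm
      have e2 : glue q ⁻¹' (pres m ⁻¹' {r}) ∩ pres n ⁻¹' {p} = ∅ := by
        ext ω
        simp only [mem_inter_iff, mem_preimage, mem_singleton_iff, mem_empty_iff_false, iff_false]
        rintro ⟨h, _⟩
        apply hc
        rw [← hpresglue q ω]
        ext i
        exact (hr _ h i (by omega)).symm
      rw [e1, e2]
  rw [Measure.restrict_apply (hms n q), Measure.restrict_apply (hms n p)]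
  have : μ.restrict (pres n ⁻¹' {q}) H = μ (pres n ⁻¹' {p} ∩ H) := by
    rw [← hmeas, Measure.map_apply (hgm q) hH, Measure.restrict_apply (hgm q hH)]
    congr 1
    ext x
    simp only [mem_inter_iff, mem_preimage, mem_singleton_iff]
    rw [and_comm, and_congr_right_iff]
    intro hx
    have : InfEquiv (glue q x) x := by
      refine ⟨n, ?_, ?_⟩
      · intro i hi; rw [htl x i hi, hfix p x hx]
      · have := hfe x n le_rfl
        rwa [hfix p x hx] at this
    exact hinv _ _ this
  rw [← this, Measure.restrict_apply hH, inter_comm]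

open Classical in
lemma level_identity' (μ : Measure (ℕ → S)) [IsFiniteMeasure μ] (hPE : PartiallyExchangeable μ)
    {H : Set (ℕ → S)} (hH : MeasurableSet H) (hinv : ∀ x y, InfEquiv x y → (x ∈ H ↔ y ∈ H))
    (K : Finset S) (t : S → List S) (V : Finset S) (n : ℕ) :
    ∫⁻ x in H, (if Bet K t V n x then 1 else 0) ∂μ = ∫⁻ x in H, alp K t V n x ∂μ :=
  level_identity μ K t V n fun _ _ h => restrict_prefix μ hPE h.1 h.2.1 h.perm hH hinv
end
end

section
/-- Substochastic matrices with a transience-type certificate. -/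
structure SubSt (P : S → S → ℝ) (r : S → ℕ) : Prop where
  nonneg : ∀ v w, 0 ≤ P v w
  le_one : ∀ v (D : Finset S), ∑ w ∈ D, P v w ≤ 1
  lt_one : ∀ v (D : Finset S), (∀ w ∈ D, r w ≤ r v ∨ P v w = 0) → ∑ w ∈ D, P v w < 1

lemma SubSt.max_principle {P : S → S → ℝ} {r : S → ℕ} (h : SubSt P r) {D : Finset S} {y : S → ℝ}
    (hy : ∀ v ∈ D, ∑ w ∈ D, P v w * y w ≤ y v) : ∀ v ∈ D, 0 ≤ y v := by
  classical
  by_contra hc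
  push Not at hc
  obtain ⟨v0, hv0, hneg0⟩ := hc
  obtain ⟨v1, hv1, hmin⟩ := D.exists_min_image y ⟨v0, hv0⟩
  set m := y v1 with hm
  have hmneg : m < 0 := (hmin v0 hv0).trans_lt hneg0
  obtain ⟨v, hv, hmax⟩ := (D.filter (fun v => y v = m)).exists_max_image r
    ⟨v1, Finset.mem_filter.2 ⟨hv1, hm.symm⟩⟩
  rw [Finset.mem_filter] at hv
  have h1 := hy v hv.1
  rw [hv.2] at h1
  have h2 : ∑ w ∈ D, P v w * (y w - m) ≤ m * (1 - ∑ w ∈ D, P v w) := by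
    simp_rw [mul_sub, Finset.sum_sub_distrib, ← Finset.sum_mul]
    linarith
  have h3 := h.le_one v D
  have h4 : ∀ w ∈ D, 0 ≤ P v w * (y w - m) := fun w hw =>
    mul_nonneg (h.nonneg v w) (sub_nonneg.2 (hmin w hw))
  have h5 : 0 ≤ ∑ w ∈ D, P v w * (y w - m) := Finset.sum_nonneg h4
  have h6 : ∑ w ∈ D, P v w * (y w - m) = 0 := by nlinarith
  have h7 := (Finset.sum_eq_zero_iff_of_nonneg h4).1 h6
  have h8 : ∑ w ∈ D, P v w < 1 := by
    apply h.lt_one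
    intro w hw
    rcases mul_eq_zero.1 (h7 w hw) with h8 | h8
    · exact Or.inr h8
    · exact Or.inl (hmax w (Finset.mem_filter.2 ⟨hw, by linarith⟩))
  nlinarith

open Classical in
lemma imat_mulVec (D : Finset S) (P : S → S → ℝ) (y : S → ℝ) (v : D) :
    (imat D P).mulVec (fun w => y w) v = y v - ∑ w ∈ D, P v w * y w := by
  simp only [Matrix.mulVec, dotProduct, imat, sub_mul, Finset.sum_sub_distrib]
  rw [← Finset.sum_coe_sort D (fun w => P v w * y w)]
  simp

open Classical in
lemma SubSt.det_ne_zero {P : S → S → ℝ} {r : S → ℕ} (h : SubSt P r) (D : Finset S) :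
    (imat D P).det ≠ 0 := by
  intro h0
  have h0' : ∃ v ≠ 0, (imat D P).mulVec v = 0 :=
    Matrix.exists_mulVec_eq_zero_iff.2 (by convert h0)
  obtain ⟨z, hz, hz0⟩ := h0'
  set y : S → ℝ := fun v => if h : v ∈ D then z ⟨v, h⟩ else 0 with hy
  have hyz : ∀ v : D, y v = z v := fun v => by simp [hy]
  have hyz' : z = fun v : D => y v := funext fun v => (hyz v).symm
  have hk : ∀ v ∈ D, y v - ∑ w ∈ D, P v w * y w = 0 := by
    intro v hv
    rw [← imat_mulVec D P y ⟨v, hv⟩, ← hyz', hz0]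
    rfl
  have p1 := h.max_principle (D := D) (y := y) (fun v hv => by linarith [hk v hv])
  have p2 := h.max_principle (D := D) (y := fun v => - y v) (fun v hv => by
    simp only [mul_neg, Finset.sum_neg_distrib]; linarith [hk v hv])
  apply hz
  ext v
  have a := p1 v v.2
  have b := p2 v v.2
  rw [← hyz v]
  simp only [Pi.zero_apply]
  linarith

open Classical in
/-- Green's function of `P` killed outside `D`. -/
noncomputable def gr (P : S → S → ℝ) (D : Finset S) (u w : S) : ℝ :=
  if h : u ∈ D ∧ w ∈ D then (imat D P)⁻¹ ⟨u, h.1⟩ ⟨w, h.2⟩ else 0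

lemma gr_of_notMem {P : S → S → ℝ} {D : Finset S} {u w : S} (h : u ∉ D) : gr P D u w = 0 := by
  simp [gr, h]

lemma gr_of_notMem' {P : S → S → ℝ} {D : Finset S} {u w : S} (h : w ∉ D) : gr P D u w = 0 := by
  simp [gr, h]

open Classical in
lemma gr_mem (P : S → S → ℝ) (D : Finset S) (u w : D) : gr P D u w = (imat D P)⁻¹ u w := by
  simp [gr]

open Classical in
lemma SubSt.gr_eq {P : S → S → ℝ} {r : S → ℕ} (h : SubSt P r) {D : Finset S} {v w : S}
    (hv : v ∈ D) (hw : w ∈ D) :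
    gr P D v w = (if v = w then 1 else 0) + ∑ u ∈ D, P v u * gr P D u w := by
  have h1 : imat D P * (imat D P)⁻¹ = 1 := Matrix.mul_nonsing_inv _ (h.det_ne_zero D).isUnit
  have h2 := congrFun (congrFun h1 ⟨v, hv⟩) ⟨w, hw⟩
  have h3 : (imat D P * (imat D P)⁻¹) ⟨v, hv⟩ ⟨w, hw⟩ =
      (imat D P).mulVec (fun u => gr P D u w) ⟨v, hv⟩ := by
    simp only [Matrix.mul_apply, Matrix.mulVec, dotProduct]
    apply Finset.sum_congr rfl
    intro u _
    rw [gr_mem P D u ⟨w, hw⟩]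
  rw [h3, imat_mulVec D P (fun u => gr P D u w)] at h2
  simp only [Matrix.one_apply, Subtype.mk.injEq] at h2
  linarith

lemma SubSt.gr_nonneg {P : S → S → ℝ} {r : S → ℕ} (h : SubSt P r) (D : Finset S) (u w : S) :
    0 ≤ gr P D u w := by
  classical
  by_cases hw : w ∈ D
  · by_cases hu : u ∈ D
    · refine h.max_principle (D := D) (y := fun u => gr P D u w) ?_ u hu
      intro v hv
      rw [h.gr_eq hv hw]
      split_ifs <;> simp
    · rw [gr_of_notMem hu]
  · rw [gr_of_notMem' hw]

lemma SubSt.gr_mono {P : S → S → ℝ} {r : S → ℕ} (h : SubSt P r) (u w : S) :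
    Monotone (fun D => gr P D u w) := by
  classical
  intro D E hDE
  simp only
  by_cases hw : w ∈ D
  · by_cases hu : u ∈ D
    · have := h.max_principle (D := D) (y := fun u => gr P E u w - gr P D u w) ?_ u hu
      · linarith
      intro v hv
      simp_rw [mul_sub, Finset.sum_sub_distrib]
      have h1 := h.gr_eq hv hw
      have h2 := h.gr_eq (hDE hv) (hDE hw)
      have h3 : ∑ u ∈ D, P v u * gr P E u w ≤ ∑ u ∈ E, P v u * gr P E u w :=
        Finset.sum_le_sum_of_subset_of_nonneg hDE fun u _ _ =>
          mul_nonneg (h.nonneg _ _) (h.gr_nonneg _ _ _)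
      linarith
    · rw [gr_of_notMem hu]; exact h.gr_nonneg _ _ _
  · rw [gr_of_notMem' hw]; exact h.gr_nonneg _ _ _

open Classical in
lemma SubSt.gr_bound {P : S → S → ℝ} {r : S → ℕ} (h : SubSt P r) {d : S → ℝ} {o : S}
    (hd0 : ∀ u, 0 ≤ d u)
    (hd : ∀ u (D : Finset S), ∑ v ∈ D, d v * P v u + (if u = o then 1 else 0) ≤ d u)
    (D : Finset S) (w : S) : gr P D o w ≤ d w := by
  by_cases hw : w ∈ D
  · by_cases ho : o ∈ D
    · have e1 : ∑ v ∈ D, d v * gr P D v w =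
          d w + ∑ u ∈ D, (∑ v ∈ D, d v * P v u) * gr P D u w := by
        have : ∀ v ∈ D, d v * gr P D v w =
            (if v = w then d v else 0) + ∑ u ∈ D, d v * P v u * gr P D u w := by
          intro v hv
          conv_lhs => rw [h.gr_eq hv hw]
          rw [mul_add, Finset.mul_sum]
          congr 1
          · split_ifs <;> simp
          · exact Finset.sum_congr rfl fun u _ => by ring
        rw [Finset.sum_congr rfl this, Finset.sum_add_distrib, Finset.sum_comm]
        simp_rw [Finset.sum_mul]
        simp [hw]
      have e2 : ∑ u ∈ D, (∑ v ∈ D, d v * P v u) * gr P D u w ≤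
          ∑ u ∈ D, (d u - if u = o then 1 else 0) * gr P D u w := by
        apply Finset.sum_le_sum
        intro u _
        apply mul_le_mul_of_nonneg_right _ (h.gr_nonneg _ _ _)
        linarith [hd u D]
      simp_rw [sub_mul, Finset.sum_sub_distrib] at e2
      have e3 : ∑ u ∈ D, (if u = o then (1:ℝ) else 0) * gr P D u w = gr P D o w := by
        simp [ho]
      linarith
    · rw [gr_of_notMem ho]; exact hd0 w
  · rw [gr_of_notMem' hw]; exact hd0 w

lemma SubSt.gr_tendsto {P : S → S → ℝ} {r : S → ℕ} (h : SubSt P r) {d : S → ℝ} {x : ℕ → S}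
    (hb0 : ∀ (D : Finset S) (w : S), gr P D (x 0) w ≤ d w)
    (hpos : ∀ i, 0 < P (x i) (x (i + 1))) (i : ℕ) (w : S) :
    ∃ c, Tendsto (fun D => gr P D (x i) w) atTop (nhds c) := by
  classical
  have hb : ∃ C : ℝ, ∀ D, gr P D (x i) w ≤ C := by
    induction i with
    | zero => exact ⟨d w, fun D => hb0 D w⟩
    | succ i ih =>
      obtain ⟨C, hC⟩ := ih
      refine ⟨C / P (x i) (x (i + 1)), fun D => ?_⟩
      set E := insert (x i) (insert (x (i + 1)) (insert w D)) with hE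
      have hDE : D ⊆ E := by intro a ha; simp [hE, ha]
      refine (h.gr_mono (x (i + 1)) w hDE).trans ?_
      simp only
      rw [le_div_iff₀ (hpos i)]
      refine le_trans ?_ (hC E)
      rw [h.gr_eq (D := E) (v := x i) (w := w) (by simp [hE]) (by simp [hE]), mul_comm]
      have h1 : P (x i) (x (i + 1)) * gr P E (x (i + 1)) w ≤ ∑ u ∈ E, P (x i) u * gr P E u w :=
        Finset.single_le_sum (f := fun u => P (x i) u * gr P E u w)
          (fun u _ => mul_nonneg (h.nonneg _ _) (h.gr_nonneg _ _ _)) (by simp [hE])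
      split_ifs <;> linarith
  obtain ⟨C, hC⟩ := hb
  exact ⟨_, tendsto_atTop_ciSup (h.gr_mono (x i) w) ⟨C, by rintro _ ⟨D, rfl⟩; exact hC D⟩⟩

open Classical in
lemma SubSt.ratio_det {P : S → S → ℝ} {r : S → ℕ} (h : SubSt P r) {K D : Finset S} (hK : K ⊆ D)
    (t : S → List S) (F : S → S) (hF : ∀ v ∈ K, (t v).getLast? = some (F v)) :
    (imat D (PF K t P)).det / (imat D P).det =
      (Matrix.of fun v w : K => gr P D v w - gr P D (F v) w).det := by
  have hinv : ((imat D P)⁻¹).det = ((imat D P).det)⁻¹ := by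
    rw [Matrix.det_nonsing_inv, Ring.inverse_eq_inv']
  rw [div_eq_mul_inv, ← hinv, ← Matrix.det_mul]
  have hent : ∀ v w : D, (imat D (PF K t P) * (imat D P)⁻¹) v w =
      gr P D v w - ∑ u ∈ D, PF K t P v u * gr P D u w := by
    intro v w
    rw [← imat_mulVec D (PF K t P) (fun u => gr P D u w)]
    simp only [Matrix.mul_apply, Matrix.mulVec, dotProduct]
    apply Finset.sum_congr rfl
    intro u _
    rw [gr_mem P D u w]
  have hentK : ∀ v w : D, (v : S) ∈ K → (imat D (PF K t P) * (imat D P)⁻¹) v w =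
      gr P D v w - gr P D (F v) w := by
    intro v w hv
    rw [hent]
    congr 1
    simp only [PF, hv, if_true, hF v hv, Option.some.injEq, ite_mul, one_mul, zero_mul]
    rw [Finset.sum_ite_eq]
    split_ifs with hD
    · rfl
    · rw [gr_of_notMem hD]
  have hentO : ∀ v w : D, (v : S) ∉ K → (imat D (PF K t P) * (imat D P)⁻¹) v w =
      if v = w then 1 else 0 := by
    intro v w hv
    rw [hent, h.gr_eq v.2 w.2]
    by_cases hvw : v = w
    · subst hvw; simp [PF, hv]
    · have hvw' : (v : S) ≠ w := fun h => hvw (Subtype.ext h)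
      simp [PF, hv, hvw]
  rw [Matrix.twoBlockTriangular_det _ (fun v : D => (v : S) ∈ K)]
  · have e1 : (Matrix.toSquareBlockProp (imat D (PF K t P) * (imat D P)⁻¹)
        (fun v : D => ¬ (v : S) ∈ K)) = 1 := by
      ext i j
      rw [Matrix.toSquareBlockProp_def]
      rw [Matrix.of_apply, hentO _ _ i.2, Matrix.one_apply]
      by_cases hij : i = j
      · subst hij; simp
      · have hij' : i.1 ≠ j.1 := fun h => hij (Subtype.ext h)
        rw [if_neg hij, if_neg hij']
    rw [e1, Matrix.det_one, mul_one]
    let e : {v : D // (v : S) ∈ K} ≃ K :=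
      { toFun := fun v => ⟨v.1, v.2⟩
        invFun := fun v => ⟨⟨v.1, hK v.2⟩, v.2⟩
        left_inv := fun v => rfl
        right_inv := fun v => rfl }
    rw [← Matrix.det_submatrix_equiv_self e]
    congr 1
    ext i j
    rw [Matrix.toSquareBlockProp_def, Matrix.of_apply, hentK _ _ i.2]
    rfl
  · intro i hi j hj
    rw [hentO i j hi, if_neg]
    rintro rfl
    exact hi hj

lemma SubSt.rat_tendsto {P : S → S → ℝ} {r : S → ℕ} (h : SubSt P r) {K : Finset S}
    (t : S → List S) (F : S → S) (hF : ∀ v ∈ K, (t v).getLast? = some (F v))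
    (hg : ∀ v ∈ K, ∀ w, (∃ c, Tendsto (fun D => gr P D v w) atTop (nhds c)) ∧
      ∃ c, Tendsto (fun D => gr P D (F v) w) atTop (nhds c)) :
    ∃ c, Tendsto (fun D => rat K t P D) atTop (nhds c) := by
  classical
  have h1 : ∀ v w : K, ∃ c, Tendsto (fun D => gr P D v w - gr P D (F v) w) atTop (nhds c) := by
    intro v w
    obtain ⟨⟨c, hc⟩, c', hc'⟩ := hg v v.2 w
    exact ⟨_, hc.sub hc'⟩
  choose c hc using h1
  have h2 : Tendsto (fun D => (Matrix.of fun v w : K => gr P D v w - gr P D (F v) w)) atTop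
      (nhds (Matrix.of c)) :=
    tendsto_pi_nhds.2 fun v => tendsto_pi_nhds.2 fun w => hc v w
  have h3 := ((continuous_id.matrix_det (A := fun M : Matrix K K ℝ => M)).tendsto (Matrix.of c)).comp h2
  refine ⟨_, (h3.const_mul ((∏ v ∈ K, ((lists (t v)).card : ℝ))⁻¹)).congr' ?_⟩
  filter_upwards [eventually_ge_atTop K] with D hD
  unfold rat
  rw [h.ratio_det hD t F hF]
  rfl
end

section
/-- transient path -/
def Tr (x : ℕ → S) : Prop := ∀ s, {i | x i = s}.Finite

lemma Tr.ev {x : ℕ → S} (h : Tr x) (V : Finset S) : ∃ N, ∀ i, N ≤ i → x i ∉ V := by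
  have hf : {i | x i ∈ V}.Finite := by
    have : {i | x i ∈ V} = ⋃ s ∈ V, {i | x i = s} := by ext i; simp
    rw [this]
    exact V.finite_toSet.biUnion fun s _ => h s
  obtain ⟨N, hN⟩ := hf.bddAbove
  exact ⟨N + 1, fun i hi hx => by have := hN hx; omega⟩

lemma stk_stable {x : ℕ → S} {v : S} {N n : ℕ} (hN : ∀ i, N ≤ i → x i ≠ v) (hn : N ≤ n) :
    stk x n v = stk x N v := by
  induction n, hn using Nat.le_induction with
  | base => rfl
  | succ n hn ih => rw [stk_succ, if_neg (hN n hn), ih, List.append_nil]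

open Classical in
/-- full stack -/
noncomputable def fstk (x : ℕ → S) (v : S) : List S :=
  if h : ∃ l, ∀ᶠ n in atTop, stk x n v = l then h.choose else []

lemma Tr.fstk_eq {x : ℕ → S} {v : S} {N n : ℕ} (hN : ∀ i, N ≤ i → x i ≠ v)
    (hn : N ≤ n) : stk x n v = fstk x v := by
  have hex : ∃ l, ∀ᶠ n in atTop, stk x n v = l :=
    ⟨stk x N v, eventually_atTop.2 ⟨N, fun n hn => stk_stable hN hn⟩⟩
  have h1 : ∀ᶠ n in atTop, stk x n v = fstk x v := by
    unfold fstk; rw [dif_pos hex]; exact hex.choose_spec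
  obtain ⟨m, hm, hm'⟩ := (h1.and (eventually_ge_atTop N)).exists
  rw [← hm, stk_stable hN hn, stk_stable hN hm']

lemma Tr.fstk_ev {x : ℕ → S} (h : Tr x) (v : S) : ∀ᶠ n in atTop, stk x n v = fstk x v := by
  obtain ⟨N, hN⟩ := h.ev {v}
  exact eventually_atTop.2 ⟨N, fun n hn => Tr.fstk_eq (fun i hi => by simpa using hN i hi) hn⟩

lemma Tr.mem_fstk {x : ℕ → S} (h : Tr x) {v w : S} :
    w ∈ fstk x v ↔ ∃ i, x i = v ∧ x (i + 1) = w := by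
  obtain ⟨N, hN⟩ := eventually_atTop.1 (h.fstk_ev v)
  constructor
  · intro hw
    rw [← hN N le_rfl, mem_stk] at hw
    obtain ⟨i, _, hi⟩ := hw
    exact ⟨i, hi⟩
  · rintro ⟨i, hi⟩
    rw [← hN (max N (i + 1)) (le_max_left _ _), mem_stk]
    exact ⟨i, by omega, hi⟩

open Classical in
lemma Tr.transNum_eq {x : ℕ → S} (h : Tr x) (v w : S) :
    transNum x v w = ((fstk x v).count w : ℕ∞) := by
  obtain ⟨N, hN⟩ := h.ev {v}
  have hN' : ∀ i, N ≤ i → x i ≠ v := fun i hi => by simpa using hN i hi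
  rw [← Tr.fstk_eq hN' le_rfl, ← transCount_eq]
  unfold transNum transCount
  have : {i | x i = v ∧ x (i + 1) = w} = {i | i < N ∧ x i = v ∧ x (i + 1) = w} := by
    ext i
    simp only [mem_ofPred_eq]
    refine ⟨fun hi => ⟨?_, hi⟩, fun hi => hi.2⟩
    by_contra hc
    exact hN' i (by omega) hi.1
  rw [this, Set.Finite.cast_ncard_eq]
  exact (Set.finite_lt_nat N).subset fun i hi => hi.1

/-- last exit relation -/
def LE (x : ℕ → S) (u w : S) : Prop := ∃ i, x i = u ∧ x (i + 1) = w ∧ ∀ j, i < j → x j ≠ u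

lemma Dset_congr' {V : Finset S} {ℓ ℓ' : S → S → Prop} (h : ∀ a, ∀ b ∈ V, ℓ a b ↔ ℓ' a b) :
    Dset V ℓ = Dset V ℓ' := by
  have : (fun a b => ℓ a b ∧ b ∈ V) = (fun a b => ℓ' a b ∧ b ∈ V) := by
    ext a b
    exact and_congr_left fun hb => h a b hb
  unfold Dset
  rw [this]

lemma Tr.ev_all {x : ℕ → S} (h : Tr x) (V : Finset S) :
    ∀ᶠ n in atTop, x n ∉ V ∧ (∀ v ∈ V, stk x n v = fstk x v) ∧
      Dset V (lstep (stk x n)) = Dset V (LE x) := by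
  classical
  obtain ⟨N, hN⟩ := h.ev V
  obtain ⟨M, hM⟩ := h.ev ((Finset.range (N + 1)).image x)
  rw [eventually_atTop]
  refine ⟨max N M, fun n hn => ?_⟩
  have hnN : N ≤ n := (le_max_left _ _).trans hn
  have hnM : M ≤ n := (le_max_right _ _).trans hn
  refine ⟨hN n hnN, fun v hv => Tr.fstk_eq (fun i hi he => hN i hi (he ▸ hv)) hnN, ?_⟩
  apply Dset_congr'
  intro u w hw
  rw [getLast_stk]
  constructor
  · rintro ⟨i, hi, h1, h2, h3⟩
    refine ⟨i, h1, h2, fun j hj => ?_⟩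
    by_cases hjn : j < n
    · exact h3 j hj hjn
    · have hiN : i < N := by
        by_contra hc
        exact hN (i + 1) (by omega) (h2 ▸ hw)
      intro he
      apply hM j (by omega)
      rw [Finset.mem_image]
      exact ⟨i, by simp; omega, h1.trans he.symm⟩
  · rintro ⟨i, h1, h2, h3⟩
    have hiN : i < N := by
      by_contra hc
      exact hN (i + 1) (by omega) (h2 ▸ hw)
    exact ⟨i, by omega, h1, h2, fun j hj _ => h3 j hj⟩

lemma Tr.Dset_tendsto {x : ℕ → S} (h : Tr x) :
    Tendsto (fun V => Dset V (LE x)) atTop atTop := by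
  classical
  rw [tendsto_atTop]
  intro K
  obtain ⟨N, hN⟩ := h.ev K
  filter_upwards [eventually_ge_atTop (K ∪ (Finset.range N).image x)] with V hV
  intro v hv
  by_contra hc
  have hvV : v ∈ V := hV (Finset.mem_union_left _ hv)
  obtain ⟨u, hu, hp⟩ := notMem_Dset hc hvV
  have : (∀ j, N ≤ j → x j ≠ u) ∧ u ∈ V := by
    clear hu
    induction hp using Relation.ReflTransGen.head_induction_on with
    | refl => exact ⟨fun j hj he => hN j hj (he ▸ hv), hvV⟩
    | head hab _ ih =>
      obtain ⟨⟨i, h1, h2, h3⟩, _⟩ := hab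
      have hiN : i < N := by
        by_contra hc
        exact ih.1 (i + 1) (by omega) h2
      refine ⟨fun j hj => h3 j (by omega), hV (Finset.mem_union_right _ ?_)⟩
      rw [Finset.mem_image]
      exact ⟨i, by simpa using hiN, h1⟩
  exact hu this.2

open Classical in
lemma sum_count_le (l : List S) (D : Finset S) : ∑ w ∈ D, l.count w ≤ l.length := by
  induction l with
  | nil => simp
  | cons a l ih =>
    simp_rw [List.count_cons, Finset.sum_add_distrib, List.length_cons]
    have : ∑ w ∈ D, (if (a == w) = true then 1 else 0) ≤ 1 := by
      simp only [beq_iff_eq]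
      rw [Finset.sum_ite_eq]
      split_ifs <;> simp
    omega

lemma Tr.exists_last {x : ℕ → S} (h : Tr x) :
    ∃ r : S → ℕ, ∀ v, (∃ i, x i = v) → x (r v) = v ∧ ∀ j, x j = v → j ≤ r v := by
  have : ∀ v, ∃ r : ℕ, (∃ i, x i = v) → x r = v ∧ ∀ j, x j = v → j ≤ r := by
    intro v
    by_cases hv : ∃ i, x i = v
    · obtain ⟨r, hr, hr'⟩ := Set.exists_max_image {i | x i = v} id (h v) hv
      exact ⟨r, fun _ => ⟨hr, fun j hj => hr' j hj⟩⟩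
    · exact ⟨0, fun h => absurd h hv⟩
  choose r hr using this
  exact ⟨r, hr⟩

open Classical in
lemma Tr.subSt {x : ℕ → S} (h : Tr x) : ∃ r, SubSt (pst (fstk x)) r := by
  obtain ⟨r, hr⟩ := h.exists_last
  have hle : ∀ v (D : Finset S), ∑ w ∈ D, pst (fstk x) v w ≤ 1 := by
    intro v D
    unfold pst
    rw [← Finset.sum_div]
    apply div_le_one_of_le₀ _ (Nat.cast_nonneg _)
    exact_mod_cast sum_count_le _ _
  have hnn : ∀ v w, 0 ≤ pst (fstk x) v w := fun v w => by unfold pst; positivity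
  refine ⟨r, hnn, hle, ?_⟩
  intro v D hD
  by_cases hv : ∃ i, x i = v
  · obtain ⟨h1, h2⟩ := hr v hv
    set w := x (r v + 1) with hw
    have hmem : w ∈ fstk x v := h.mem_fstk.2 ⟨r v, h1, rfl⟩
    have hpos : 0 < pst (fstk x) v w := by
      unfold pst
      have a1 : 0 < (fstk x v).count w := List.count_pos_iff.2 hmem
      have a2 : 0 < (fstk x v).length := List.length_pos_of_mem hmem
      positivity
    have hrw := (hr w ⟨_, rfl⟩).2 (r v + 1) rfl
    have hwD : w ∉ D := by
      intro hwD
      rcases hD w hwD with h3 | h3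
      · omega
      · exact hpos.ne' h3
    have := hle v (insert w D)
    rw [Finset.sum_insert hwD] at this
    linarith
  · have : fstk x v = [] := by
      rw [List.eq_nil_iff_forall_not_mem]
      intro w hw
      obtain ⟨i, hi, _⟩ := h.mem_fstk.1 hw
      exact hv ⟨i, hi⟩
    simp [pst, this]

open Classical in
lemma Tr.balance {x : ℕ → S} (h : Tr x) (u : S) (D : Finset S) :
    ∑ v ∈ D, ((fstk x v).length : ℝ) * pst (fstk x) v u + (if u = x 0 then 1 else 0) ≤
      (fstk x u).length := by
  obtain ⟨N, hN⟩ := h.ev (insert u D)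
  have hs : ∀ v ∈ insert u D, stk x N v = fstk x v := fun v hv =>
    Tr.fstk_eq (fun i hi he => hN i hi (he ▸ hv)) le_rfl
  have hb := balance_stk x N (D ∪ (Finset.range N).image x)
    (fun i hi => Finset.mem_union_right _ (Finset.mem_image_of_mem _ (by simpa using hi))) u
  have hu : u ≠ x N := by
    rintro rfl
    exact hN N le_rfl (Finset.mem_insert_self _ _)
  rw [if_neg hu, hs u (Finset.mem_insert_self _ _)] at hb
  have h1 : ∑ v ∈ D, (fstk x v).count u ≤
      ∑ v ∈ D ∪ (Finset.range N).image x, (stk x N v).count u := by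
    have e : ∑ v ∈ D, (fstk x v).count u = ∑ v ∈ D, (stk x N v).count u :=
      Finset.sum_congr rfl (fun v hv => by rw [hs v (Finset.mem_insert_of_mem hv)])
    rw [e]
    exact Finset.sum_le_sum_of_subset Finset.subset_union_left
  have h2 : ∀ v ∈ D, ((fstk x v).length : ℝ) * pst (fstk x) v u = (fstk x v).count u := by
    intro v _
    unfold pst
    by_cases hl : fstk x v = []
    · simp [hl]
    · have : ((fstk x v).length : ℝ) ≠ 0 := by
        exact_mod_cast (List.length_pos_iff.2 hl).ne'
      field_simp
  rw [Finset.sum_congr rfl h2]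
  have h3 : ∑ v ∈ D, (fstk x v).count u + (if u = x 0 then 1 else 0) ≤ (fstk x u).length := by
    omega
  exact_mod_cast h3

open Classical in
lemma Tr.rat_tendsto {x : ℕ → S} (h : Tr x) (K : Finset S) (t : S → List S)
    (ht : ∀ v ∈ K, t v ≠ []) (hJ : ∀ v ∈ K, (fstk x v).Perm (t v)) :
    ∃ c, Tendsto (fun D => rat K t (pst (fstk x)) D) atTop (nhds c) := by
  obtain ⟨r, hr⟩ := h.subSt
  have hb0 : ∀ (D : Finset S) (w : S), gr (pst (fstk x)) D (x 0) w ≤ ((fstk x w).length : ℝ) :=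
    hr.gr_bound (d := fun w => ((fstk x w).length : ℝ)) (fun _ => Nat.cast_nonneg _)
      (fun u D => h.balance u D)
  have hpos : ∀ i, 0 < pst (fstk x) (x i) (x (i + 1)) := by
    intro i
    have hmem : x (i + 1) ∈ fstk x (x i) := h.mem_fstk.2 ⟨i, rfl, rfl⟩
    unfold pst
    have a1 := List.count_pos_iff.2 hmem
    have a2 := List.length_pos_of_mem hmem
    positivity
  have hg := hr.gr_tendsto (d := fun w => ((fstk x w).length : ℝ)) hb0 hpos
  have hF : ∀ v, ∃ f, v ∈ K → (t v).getLast? = some f := by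
    intro v
    by_cases hv : v ∈ K
    · exact ⟨(t v).getLast (ht v hv), fun _ => List.getLast?_eq_some_getLast _⟩
    · exact ⟨v, fun h => absurd h hv⟩
  choose F hF using hF
  apply hr.rat_tendsto t F hF
  intro v hv w
  have hm : F v ∈ fstk x v := (hJ v hv).mem_iff.2 (List.mem_of_getLast? (hF v hv))
  obtain ⟨i, h1, h2⟩ := h.mem_fstk.1 hm
  rw [← h2]
  exact ⟨h1 ▸ hg i w, hg (i + 1) w⟩
end

section
/-- limit level `V` density -/
noncomputable def alpV (K : Finset S) (t : S → List S) (V : Finset S) (x : ℕ → S) : ℝ≥0∞ :=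
  open Classical in
  if K ⊆ Dset V (LE x) ∧ ∀ v ∈ K, (fstk x v).Perm (t v) then
    ENNReal.ofReal (rat K t (pst (fstk x)) (Dset V (LE x))) else 0

/-- limit level `V` event -/
def BetV (K : Finset S) (t : S → List S) (V : Finset S) (x : ℕ → S) : Prop :=
  K ⊆ Dset V (LE x) ∧ ∀ v ∈ K, fstk x v = t v

/-- transition matrix in terms of transition numbers -/
noncomputable def Pm (x : ℕ → S) (v w : S) : ℝ :=
  (transNum x v w : ℝ≥0∞).toReal / (∑' u, (transNum x v u : ℝ≥0∞)).toReal

open Classical in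
/-- limit density -/
noncomputable def alpI (K : Finset S) (t : S → List S) (V : ℕ → Finset S) (x : ℕ → S) : ℝ≥0∞ :=
  if ∀ v ∈ K, ∀ w, transNum x v w = ((t v).count w : ℕ∞) then
    limsup (fun m => ENNReal.ofReal (rat K t (Pm x) (V m))) atTop else 0

lemma rat_congr {K : Finset S} {t : S → List S} {P P' : S → S → ℝ} {D : Finset S}
    (h : ∀ v ∈ D, ∀ w, P v w = P' v w) : rat K t P D = rat K t P' D := by
  have h1 : imat D P = imat D P' := by
    ext v w; simp [imat, h v v.2 w]
  have h2 : imat D (PF K t P) = imat D (PF K t P') := by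
    ext v w; simp [imat, PF, h v v.2 w]
  unfold rat
  rw [h1, h2]

open Classical in
lemma tsum_count (l : List S) : ∑' u, ((l.count u : ℕ) : ℝ≥0∞) = l.length := by
  induction l with
  | nil => simp
  | cons a l ih =>
    simp_rw [List.count_cons, Nat.cast_add, ENNReal.tsum_add, ih, List.length_cons, Nat.cast_add]
    congr 1
    simp only [beq_iff_eq]
    rw [tsum_eq_single a (fun b hb => by simp [Ne.symm hb])]
    simp

open Classical in
lemma Tr.Pm_eq {x : ℕ → S} (h : Tr x) : Pm x = pst (fstk x) := by
  ext v w
  unfold Pm pst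
  simp_rw [h.transNum_eq]
  have := tsum_count (fstk x v)
  simp [this]

lemma Tr.lim1 {x : ℕ → S} (h : Tr x) (K : Finset S) (t : S → List S) (V : Finset S) :
    ∀ᶠ n in atTop, alp K t V n x = alpV K t V x ∧ (Bet K t V n x ↔ BetV K t V x) := by
  classical
  filter_upwards [h.ev_all V] with n hn
  obtain ⟨h1, h2, h3⟩ := hn
  unfold alp alpV Bet BetV
  rw [h3]
  have hD := Dset_subset V (LE x)
  have e1 : rat K t (pst (stk x n)) (Dset V (LE x)) = rat K t (pst (fstk x)) (Dset V (LE x)) := by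
    apply rat_congr
    intro v hv w
    unfold pst
    rw [h2 v (hD hv)]
  constructor
  · by_cases hK : K ⊆ Dset V (LE x)
    · have e2 : (∀ v ∈ K, (stk x n v).Perm (t v)) ↔ (∀ v ∈ K, (fstk x v).Perm (t v)) :=
        forall₂_congr fun v hv => by rw [h2 v (hD (hK hv))]
      simp only [h1, hK, e2, not_false_eq_true, true_and]
      split_ifs
      · convert congrArg ENNReal.ofReal e1
      · rfl
    · simp [hK]
  · by_cases hK : K ⊆ Dset V (LE x)
    · have e2 : (∀ v ∈ K, stk x n v = t v) ↔ (∀ v ∈ K, fstk x v = t v) :=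
        forall₂_congr fun v hv => by rw [h2 v (hD (hK hv))]
      simp [h1, hK, e2]
    · simp [hK]

lemma Tr.lim2 {x : ℕ → S} (h : Tr x) (K : Finset S) (t : S → List S) (ht : ∀ v ∈ K, t v ≠ [])
    {V : ℕ → Finset S} (hV : Tendsto V atTop atTop) :
    Tendsto (fun m => alpV K t (V m) x) atTop (nhds (alpI K t V x)) ∧
      ∀ᶠ m in atTop, (BetV K t (V m) x ↔ ∀ v ∈ K, fstk x v = t v) := by
  classical
  have hKD : ∀ᶠ m in atTop, K ⊆ Dset (V m) (LE x) :=
    (h.Dset_tendsto.comp hV).eventually (eventually_ge_atTop K)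
  constructor
  · have hJ : (∀ v ∈ K, ∀ w, transNum x v w = ((t v).count w : ℕ∞)) ↔
        ∀ v ∈ K, (fstk x v).Perm (t v) := by
      refine forall₂_congr fun v hv => ?_
      rw [List.perm_iff_count]
      refine forall_congr' fun w => ?_
      rw [h.transNum_eq]
      exact_mod_cast Iff.rfl
    by_cases hJx : ∀ v ∈ K, (fstk x v).Perm (t v)
    · obtain ⟨c, hc⟩ := h.rat_tendsto K t ht hJx
      have e1 : alpI K t V x = ENNReal.ofReal c := by
        unfold alpI
        rw [if_pos (hJ.2 hJx), h.Pm_eq]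
        exact (ENNReal.tendsto_ofReal (hc.comp hV)).limsup_eq
      rw [e1]
      refine (ENNReal.tendsto_ofReal (hc.comp (h.Dset_tendsto.comp hV))).congr' ?_
      filter_upwards [hKD] with m hm
      unfold alpV
      rw [if_pos ⟨hm, hJx⟩]
      rfl
    · have e1 : alpI K t V x = 0 := by
        unfold alpI; rw [if_neg (fun h => hJx (hJ.1 h))]
      rw [e1]
      refine tendsto_const_nhds.congr fun m => ?_
      unfold alpV
      rw [if_neg (fun h => hJx h.2)]
  · filter_upwards [hKD] with m hm
    unfold BetV
    simp [hm]

/-- cylinder in terms of stacks -/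
def Cst (K : Finset S) (t : S → List S) : Set (ℕ → S) :=
  {x | ∀ v ∈ K, ∀ᶠ n in atTop, stk x n v = t v}

lemma Tr.mem_Cst {x : ℕ → S} (h : Tr x) {K : Finset S} {t : S → List S} :
    x ∈ Cst K t ↔ ∀ v ∈ K, fstk x v = t v := by
  refine forall₂_congr fun v hv => ?_
  constructor
  · intro h1
    obtain ⟨n, h2, h3⟩ := (h1.and (h.fstk_ev v)).exists
    exact h3.symm.trans h2
  · intro h1
    rw [← h1]
    exact h.fstk_ev v

section
variable [Countable S] [MeasurableSpace S] [DiscreteMeasurableSpace S]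

lemma measurableSet_Cst (K : Finset S) (t : S → List S) : MeasurableSet (Cst K t) := by
  have : Cst K t = ⋂ v ∈ K, ⋃ N, ⋂ n, ⋂ (_ : N ≤ n), {x | stk x n v = t v} := by
    ext x; simp [Cst]
  rw [this]
  refine Finset.measurableSet_biInter _ fun v _ => MeasurableSet.iUnion fun N =>
    MeasurableSet.iInter fun n => MeasurableSet.iInter fun _ => ?_
  apply Measurable.setOf
  apply measurable_prefix (n := n)
  intro x
  rw [stk_congr (fun i hi => pext_pres x hi) v]

lemma key_identity (μ : Measure (ℕ → S)) [IsFiniteMeasure μ] (hPE : PartiallyExchangeable μ)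
    (hTr : ∀ᵐ x ∂μ, Tr x)
    {H : Set (ℕ → S)} (hH : MeasurableSet H) (hinv : ∀ x y, InfEquiv x y → (x ∈ H ↔ y ∈ H))
    (K : Finset S) (t : S → List S) (ht : ∀ v ∈ K, t v ≠ []) {V : ℕ → Finset S}
    (hV : Tendsto V atTop atTop) :
    μ (H ∩ Cst K t) = ∫⁻ x in H, alpI K t V x ∂μ := by
  classical
  have hTr' : ∀ᵐ x ∂(μ.restrict H), Tr x := ae_restrict_of_ae hTr
  have one_ne : ∫⁻ _, (1 : ℝ≥0∞) ∂(μ.restrict H) ≠ ⊤ := by simp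
  have ma : ∀ V n, Measurable (alp K t V n) := fun V n => measurable_prefix (alp_pext K t V n)
  have mb : ∀ V n, Measurable (fun x => if Bet K t V n x then (1:ℝ≥0∞) else 0) :=
    fun V n => measurable_prefix (n := n) fun x => by simp only [bet_pext]
  have ca : ∀ V, ∀ᵐ x ∂(μ.restrict H),
      Tendsto (fun n => alp K t V n x) atTop (nhds (alpV K t V x)) := by
    intro V
    filter_upwards [hTr'] with x hx
    refine tendsto_const_nhds.congr' ?_
    filter_upwards [hx.lim1 K t V] with n hn
    exact hn.1.symm
  have cb : ∀ V, ∀ᵐ x ∂(μ.restrict H),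
      Tendsto (fun n => if Bet K t V n x then (1:ℝ≥0∞) else 0) atTop
        (nhds (if BetV K t V x then (1:ℝ≥0∞) else 0)) := by
    intro V
    filter_upwards [hTr'] with x hx
    refine tendsto_const_nhds.congr' ?_
    filter_upwards [hx.lim1 K t V] with n hn
    simp only [hn.2]
  have la := fun V => tendsto_lintegral_of_dominated_convergence (fun _ => (1 : ℝ≥0∞)) (ma V)
    (fun n => ae_of_all _ (alp_le_one K t V n)) one_ne (ca V)
  have lb := fun V => tendsto_lintegral_of_dominated_convergence (fun _ => (1 : ℝ≥0∞)) (mb V)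
    (fun n => ae_of_all _ fun x => by dsimp only; split_ifs <;> simp) one_ne (cb V)
  have e1 : ∀ V, ∫⁻ x in H, alpV K t V x ∂μ =
      ∫⁻ x in H, (if BetV K t V x then (1:ℝ≥0∞) else 0) ∂μ := by
    intro V
    refine tendsto_nhds_unique (la V) ((lb V).congr fun n => ?_)
    exact level_identity' μ hPE hH hinv K t V n
  have maV : ∀ V, AEMeasurable (alpV K t V) (μ.restrict H) := fun V =>
    aemeasurable_of_tendsto_metrizable_ae _ (fun n => (ma V n).aemeasurable) (ca V)
  have mbV : ∀ V, AEMeasurable (fun x => if BetV K t V x then (1:ℝ≥0∞) else 0) (μ.restrict H) :=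
    fun V => aemeasurable_of_tendsto_metrizable_ae _ (fun n => (mb V n).aemeasurable) (cb V)
  have leV : ∀ V, ∀ᵐ x ∂(μ.restrict H), alpV K t V x ≤ 1 := by
    intro V
    filter_upwards [ca V] with x hx
    exact le_of_tendsto' hx fun n => alp_le_one K t V n x
  have la2 := tendsto_lintegral_of_dominated_convergence' (fun _ => (1 : ℝ≥0∞)) (fun m => maV (V m))
    (fun m => leV (V m)) one_ne (f := alpI K t V) (by
      filter_upwards [hTr'] with x hx
      exact (hx.lim2 K t ht hV).1)
  have lb2 := tendsto_lintegral_of_dominated_convergence' (fun _ => (1 : ℝ≥0∞)) (fun m => mbV (V m))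
    (fun m => ae_of_all _ fun x => by dsimp only; split_ifs <;> simp) one_ne
    (f := fun x => (Cst K t).indicator (fun _ => (1:ℝ≥0∞)) x) (by
      filter_upwards [hTr'] with x hx
      refine tendsto_const_nhds.congr' ?_
      filter_upwards [(hx.lim2 K t ht hV).2] with m hm
      simp only [hm, Set.indicator_apply, hx.mem_Cst])
  have := tendsto_nhds_unique la2 (lb2.congr fun m => (e1 (V m)).symm)
  rw [this, lintegral_indicator (measurableSet_Cst K t)]
  simp [Measure.restrict_apply, measurableSet_Cst, inter_comm]
end
end

section
/-- functions of one transition number are measurable -/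
lemma measurable_transNum {β : Type} [MeasurableSpace β] (g : ℕ∞ → β) (u v : S) :
    Measurable[transSigma S] (fun x => g (transNum x u v)) := by
  intro s _
  have h : MeasurableSpace.comap (fun x : ℕ → S => transNum x u v) (⊤ : MeasurableSpace ℕ∞) ≤
      transSigma S :=
    le_iSup_of_le u (le_iSup_of_le v le_rfl)
  exact h _ ⟨g ⁻¹' s, trivial, rfl⟩

section
variable [Countable S]

lemma measurable_Pm (v w : S) : Measurable[transSigma S] (fun x => Pm x v w) := by
  letI : MeasurableSpace (ℕ → S) := transSigma S
  unfold Pm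
  have h : ∀ w, Measurable (fun x : ℕ → S => (transNum x v w : ℝ≥0∞)) := fun w =>
    measurable_transNum (fun k => (k : ℝ≥0∞)) v w
  exact (h w).ennreal_toReal.div (Measurable.tsum h).ennreal_toReal

lemma measurable_rat (K : Finset S) (t : S → List S) (D : Finset S) :
    Measurable[transSigma S] (fun x => rat K t (Pm x) D) := by
  classical
  letI : MeasurableSpace (ℕ → S) := transSigma S
  have h := measurable_Pm (S := S)
  have hPF : ∀ v w, Measurable (fun x => PF K t (Pm x) v w) := by
    intro v w
    unfold PF
    by_cases hv : v ∈ K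
    · simp only [hv, if_true]; exact measurable_const
    · simp only [hv, if_false]; exact h v w
  unfold rat
  simp only [Matrix.det_apply, imat]
  refine measurable_const.mul (Measurable.div ?_ ?_)
  · refine Finset.measurable_sum _ fun σ _ => Measurable.const_smul ?_ _
    exact Finset.measurable_prod _ fun i _ => measurable_const.sub (hPF _ _)
  · refine Finset.measurable_sum _ fun σ _ => Measurable.const_smul ?_ _
    exact Finset.measurable_prod _ fun i _ => measurable_const.sub (h _ _)

lemma measurable_alpI (K : Finset S) (t : S → List S) (V : ℕ → Finset S) :
    Measurable[transSigma S] (alpI K t V) := by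
  classical
  letI : MeasurableSpace (ℕ → S) := transSigma S
  unfold alpI
  refine Measurable.ite ?_ (Measurable.limsup fun m => (measurable_rat K t (V m)).ennreal_ofReal)
    measurable_const
  have : {x : ℕ → S | ∀ v ∈ K, ∀ w, transNum x v w = ((t v).count w : ℕ∞)} =
      ⋂ v ∈ K, ⋂ w, {x | transNum x v w = ((t v).count w : ℕ∞)} := by
    ext x; simp
  rw [this]
  refine Finset.measurableSet_biInter _ fun v _ => MeasurableSet.iInter fun w => ?_
  exact Measurable.setOf (measurable_transNum (fun k => k = ((t v).count w : ℕ∞)) v w)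

variable [MeasurableSpace S] [DiscreteMeasurableSpace S]

lemma transSigma_le : transSigma S ≤ (MeasurableSpace.pi : MeasurableSpace (ℕ → S)) := by
  classical
  refine iSup_le fun u => iSup_le fun v => ?_
  have h1 : Measurable (fun x : ℕ → S => ∑' i : ℕ, {i : ℕ | x i = u ∧ x (i + 1) = v}.indicator
      (fun _ => (1 : ℝ≥0∞)) i) := by
    refine Measurable.tsum fun i => ?_
    simp only [Set.indicator_apply, mem_ofPred_eq]
    refine Measurable.ite ?_ measurable_const measurable_const
    have a := (measurableSet_singleton u).preimage (measurable_pi_apply (X := fun _ : ℕ => S) i)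
    have b := (measurableSet_singleton v).preimage
      (measurable_pi_apply (X := fun _ : ℕ => S) (i + 1))
    exact a.inter b
  have h2 : ∀ x : ℕ → S, ∑' i : ℕ, {i : ℕ | x i = u ∧ x (i + 1) = v}.indicator
      (fun _ => (1 : ℝ≥0∞)) i = (transNum x u v : ℝ≥0∞) := by
    intro x
    rw [← tsum_subtype]
    exact ENNReal.tsum_set_one _
  simp_rw [h2] at h1
  rintro _ ⟨s, _, rfl⟩
  have : (fun x : ℕ → S => transNum x u v) ⁻¹' s =
      (fun x : ℕ → S => (transNum x u v : ℝ≥0∞)) ⁻¹' ((fun k : ℕ∞ => (k : ℝ≥0∞)) '' s) := by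
    ext x
    simp only [mem_preimage, mem_image]
    constructor
    · intro h; exact ⟨_, h, rfl⟩
    · rintro ⟨k, hk, he⟩
      rwa [← ENat.toENNReal_inj.1 he]
  rw [this]
  exact h1 ((Set.to_countable s).image _).measurableSet

lemma tailSigma_le : tailSigma S ≤ (MeasurableSpace.pi : MeasurableSpace (ℕ → S)) := by
  refine iInf_le_of_le 0 ?_
  rw [← measurable_iff_comap_le]
  exact measurable_pi_lambda _ fun i => measurable_pi_apply _
end

lemma InfEquiv.transNum_eq {x y : ℕ → S} (h : InfEquiv x y) (u v : S) :
    transNum x u v = transNum y u v := by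
  obtain ⟨N, h1, -, h2⟩ := h
  have key : ∀ z : ℕ → S, transNum z u v = (transCount z N u v : ℕ∞) +
      Set.encard {i | N ≤ i ∧ z i = u ∧ z (i + 1) = v} := by
    intro z
    unfold transNum transCount
    rw [Set.Finite.cast_ncard_eq ((Set.finite_lt_nat N).subset fun i hi => hi.1),
      ← Set.encard_union_eq]
    · congr 1
      ext i
      simp only [mem_ofPred_eq, mem_union]
      have := lt_or_ge i N
      tauto
    · rw [Set.disjoint_left]
      rintro i ⟨hi, _⟩ ⟨hi', _⟩
      omega
  rw [key x, key y, h2 u v]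
  congr 2
  ext i
  simp only [mem_ofPred_eq]
  refine and_congr_right fun hi => ?_
  rw [h1 i hi, h1 (i + 1) (by omega)]

lemma transSigma_inv {H : Set (ℕ → S)} (hH : MeasurableSet[transSigma S] H) {x y : ℕ → S}
    (h : InfEquiv x y) : x ∈ H ↔ y ∈ H := by
  have hle : transSigma S ≤
      MeasurableSpace.comap (fun (x : ℕ → S) (p : S × S) => transNum x p.1 p.2) ⊤ := by
    refine iSup_le fun u => iSup_le fun v => ?_
    rintro _ ⟨s, _, rfl⟩
    exact ⟨(fun f => f (u, v)) ⁻¹' s, trivial, rfl⟩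
  obtain ⟨s, _, rfl⟩ := hle _ hH
  simp only [mem_preimage]
  have : (fun p : S × S => transNum x p.1 p.2) = fun p : S × S => transNum y p.1 p.2 :=
    funext fun p => h.transNum_eq _ _
  rw [this]

lemma tailSigma_inv [MeasurableSpace S] {H : Set (ℕ → S)} (hH : MeasurableSet[tailSigma S] H)
    {x y : ℕ → S} (h : InfEquiv x y) : x ∈ H ↔ y ∈ H := by
  obtain ⟨N, h1, -⟩ := h
  obtain ⟨s, _, rfl⟩ := (iInf_le _ N : tailSigma S ≤ _) _ hH
  simp only [mem_preimage]
  have : (fun i => x (i + N)) = fun i => y (i + N) := funext fun i => h1 _ (by omega)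
  rw [this]

/-- Abstract step: agreement on a set whose conditional probability is known. -/
lemma density_step {α : Type} {m m0 : MeasurableSpace α} (hm : m ≤ m0) (μ : Measure[m0] α)
    [IsFiniteMeasure μ] {A C : Set α} (hC : MeasurableSet[m0] C)
    {a f : α → ℝ≥0∞} (ha : Measurable[m] a) (hf : Measurable[m] f)
    (hfA : ∀ H, MeasurableSet[m] H → μ (H ∩ A) = ∫⁻ x in H, f x ∂μ)
    (hA1 : μ (A ∩ C) = ∫⁻ x in A, a x ∂μ)
    (hC1 : ∀ H, MeasurableSet[m] H → μ (H ∩ C) = ∫⁻ x in H, a x ∂μ) :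
    μ (A ∩ C) = ∫⁻ x in C, f x ∂μ := by
  have gen : ∀ (D : Set α) (g h : α → ℝ≥0∞), Measurable[m] g → Measurable[m] h →
      (∀ H, MeasurableSet[m] H → μ (H ∩ D) = ∫⁻ x in H, g x ∂μ) →
      ∫⁻ x in D, h x ∂μ = ∫⁻ x, g x * h x ∂μ := by
    intro D g h hg hh hD
    have e : (μ.restrict D).trim hm = (μ.trim hm).withDensity g := by
      refine @Measure.ext _ m _ _ fun H hH => ?_
      rw [trim_measurableSet_eq hm hH, Measure.restrict_apply (hm _ hH), hD H hH,
        withDensity_apply _ hH, restrict_trim hm μ hH, lintegral_trim hm hg]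
    rw [← lintegral_trim hm hh, e, lintegral_withDensity_eq_lintegral_mul _ hg hh,
      lintegral_trim hm (hg.mul hh)]
    rfl
  rw [hA1, gen A f a hf ha hfA, gen C a f ha hf hC1]
  exact lintegral_congr fun x => mul_comm _ _

lemma exists_density {α : Type} {m m0 : MeasurableSpace α} (hm : m ≤ m0) (μ : Measure[m0] α)
    [IsFiniteMeasure μ] (A : Set α) :
    ∃ f : α → ℝ≥0∞, Measurable[m] f ∧
      ∀ H, MeasurableSet[m] H → μ (H ∩ A) = ∫⁻ x in H, f x ∂μ := by
  have hac : (μ.restrict A).trim hm ≪ μ.trim hm :=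
    Measure.AbsolutelyContinuous.trim Measure.restrict_le_self.absolutelyContinuous hm
  refine ⟨((μ.restrict A).trim hm).rnDeriv (μ.trim hm), Measure.measurable_rnDeriv _ _, ?_⟩
  intro H hH
  have h1 := Measure.withDensity_rnDeriv_eq _ _ hac
  have h2 : ((μ.restrict A).trim hm) H = μ (H ∩ A) := by
    rw [trim_measurableSet_eq hm hH, Measure.restrict_apply (hm _ hH)]
  rw [← h2, ← lintegral_trim hm (Measure.measurable_rnDeriv _ _), ← restrict_trim hm μ hH,
    ← withDensity_apply _ hH, h1]

lemma stk_prefix (x : ℕ → S) {n k : ℕ} (h : n ≤ k) (v : S) : stk x n v <+: stk x k v := by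
  obtain ⟨j, rfl⟩ := Nat.exists_eq_add_of_le h
  exact ⟨_, (stk_add x n j v).symm⟩

lemma Tr.stk_prefix {x : ℕ → S} (h : Tr x) (n : ℕ) (v : S) : stk x n v <+: fstk x v := by
  obtain ⟨k, hk, hk'⟩ := ((h.fstk_ev v).and (eventually_ge_atTop n)).exists
  rw [← hk]
  exact DF.stk_prefix x hk' v

lemma Tr.cyl_iff {x w : ℕ → S} (h : Tr x) (h0 : x 0 = w 0) (n : ℕ) :
    (∀ i ≤ n, x i = w i) ↔ ∀ v, (∃ i < n, w i = v) → stk w n v <+: fstk x v := by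
  constructor
  · intro he v _
    rw [← stk_congr he v]
    exact h.stk_prefix n v
  · intro hp
    suffices ∀ i ≤ n, ∀ j ≤ i, x j = w j from fun i hi => this i hi i le_rfl
    intro i
    induction i with
    | zero =>
      intro _ j hj
      obtain rfl : j = 0 := by omega
      exact h0
    | succ i ih =>
      intro hi j hj
      have ih := ih (by omega)
      by_cases hji : j ≤ i
      · exact ih j hji
      obtain rfl : j = i + 1 := by omega
      have h1 : stk w (i + 1) (w i) <+: fstk x (w i) :=
        (DF.stk_prefix w hi (w i)).trans (hp (w i) ⟨i, by omega, rfl⟩)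
      have h2 := h.stk_prefix (i + 1) (w i)
      rw [stk_succ, if_pos rfl] at h1
      rw [stk_succ, if_pos (ih i le_rfl), stk_congr ih] at h2
      have h3 := List.prefix_of_prefix_length_le h1 h2 (by simp)
      have h4 := h3.eq_of_length (by simp)
      have h5 := List.append_cancel_left h4
      simpa using h5.symm

open Classical in
/-- extend a finite family of lists -/
noncomputable def extK (K : Finset S) (t : K → List S) (v : S) : List S :=
  if h : v ∈ K then t ⟨v, h⟩ else []

lemma extK_apply {K : Finset S} (t : K → List S) {v : S} (h : v ∈ K) :
    extK K t v = t ⟨v, h⟩ := by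
  simp [extK, h]

lemma Cst_disjoint {K : Finset S} {t t' : K → List S} (h : t ≠ t') :
    Disjoint (Cst K (extK K t)) (Cst K (extK K t')) := by
  rw [Set.disjoint_left]
  intro x hx hx'
  apply h
  ext1 v
  obtain ⟨n, h1, h2⟩ := ((hx v v.2).and (hx' v v.2)).exists
  rw [extK_apply t v.2] at h1
  rw [extK_apply t' v.2] at h2
  exact h1.symm.trans h2

section
variable [Countable S] [MeasurableSpace S] [DiscreteMeasurableSpace S]

lemma measure_eq_of_Cst (μ ν₁ ν₂ : Measure (ℕ → S)) [IsFiniteMeasure ν₁] (hTr : ∀ᵐ x ∂μ, Tr x)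
    (s0 : S) (h0 : ∀ᵐ x ∂μ, x 0 = s0) (h1 : ν₁ ≪ μ) (h2 : ν₂ ≪ μ)
    (h : ∀ (K : Finset S) (t : S → List S), (∀ v ∈ K, t v ≠ []) →
      ν₁ (Cst K t) = ν₂ (Cst K t)) : ν₁ = ν₂ := by
  classical
  apply measure_ext_cyl ν₁ ν₂ 0
  intro n _ r
  obtain ⟨w, rfl⟩ : ∃ w, pres n w = r := ⟨pext r, pres_pext r⟩
  rw [pres_preimage]
  by_cases hw : w 0 = s0
  · set K : Finset S := (Finset.range n).image w with hK
    have hKm : ∀ v, v ∈ K ↔ ∃ i < n, w i = v := by simp [hK]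
    set G : Set (K → List S) := {t | ∀ v : K, stk w n v <+: t v} with hG
    have hcyl : ({ω | ∀ i ≤ n, ω i = w i} : Set (ℕ → S)) =ᵐ[μ]
        ⋃ t : G, Cst K (extK K t.1) := by
      filter_upwards [hTr, h0] with x hx hx0
      apply propext
      change (∀ i ≤ n, x i = w i) ↔ x ∈ ⋃ t : G, Cst K (extK K t.1)
      rw [hx.cyl_iff (hx0.trans hw.symm), mem_iUnion]
      constructor
      · intro hp
        refine ⟨⟨fun v => fstk x v, fun v => hp v ((hKm v).1 v.2)⟩, ?_⟩
        rw [hx.mem_Cst]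
        intro v hv
        rw [extK_apply _ hv]
      · rintro ⟨⟨t, ht⟩, hxt⟩ v hv
        rw [hx.mem_Cst] at hxt
        have hv' := (hKm v).2 hv
        rw [hxt v hv', extK_apply _ hv']
        exact ht ⟨v, hv'⟩
    rw [measure_congr (h1.ae_eq hcyl), measure_congr (h2.ae_eq hcyl)]
    have hd : Pairwise (Function.onFun Disjoint fun t : G => Cst K (extK K t.1)) :=
      fun t t' htt => Cst_disjoint fun he => htt (Subtype.ext he)
    rw [measure_iUnion hd fun t => measurableSet_Cst _ _,
      measure_iUnion hd fun t => measurableSet_Cst _ _]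
    refine tsum_congr fun t => h _ _ fun v hv => ?_
    rw [extK_apply _ hv]
    have := t.2 ⟨v, hv⟩
    intro he
    rw [he, List.prefix_nil] at this
    exact stk_ne_nil.2 ((hKm v).1 hv) this
  · have hz : μ {ω | ∀ i ≤ n, ω i = w i} = 0 := by
      refine measure_mono_null ?_ (ae_iff.1 h0)
      intro x hx hx0
      exact hw ((hx 0 (Nat.zero_le _)).symm.trans hx0)
    rw [h1 hz, h2 hz]

lemma stmt_aux (μ : Measure (ℕ → S)) [IsFiniteMeasure μ] (hPE : PartiallyExchangeable μ)
    (hTr : ∀ᵐ x ∂μ, Tr x) (s0 : S) (h0 : ∀ᵐ x ∂μ, x 0 = s0)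
    (A : Set (ℕ → S)) (hA : MeasurableSet[tailSigma S] A) :
    ∃ B, MeasurableSet[transSigma S] B ∧ μ (symmDiff A B) = 0 := by
  obtain ⟨V, hV⟩ := exists_seq_tendsto (atTop : Filter (Finset S))
  have hA0 : MeasurableSet A := tailSigma_le _ hA
  obtain ⟨f, hf, hfA⟩ := exists_density transSigma_le μ A
  have hf0 : Measurable f := hf.mono transSigma_le le_rfl
  have hkey := fun K t ht {H : Set (ℕ → S)} hH hinv =>
    key_identity μ hPE hTr (H := H) hH hinv K t ht hV
  have heq : μ.restrict A = μ.withDensity f := by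
    refine measure_eq_of_Cst μ _ _ hTr s0 h0 Measure.restrict_le_self.absolutelyContinuous
      (withDensity_absolutelyContinuous _ _) fun K t ht => ?_
    have hC := measurableSet_Cst K t
    rw [Measure.restrict_apply hC, withDensity_apply _ hC, inter_comm]
    refine density_step transSigma_le μ hC (measurable_alpI K t V) hf hfA ?_ ?_
    · exact hkey K t ht hA0 fun x y hxy => tailSigma_inv hA hxy
    · intro H hH
      exact hkey K t ht (transSigma_le _ hH) fun x y hxy => transSigma_inv hH hxy
  have heq2 : A.indicator (fun _ => (1 : ℝ≥0∞)) =ᵐ[μ] f := by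
    rw [← withDensity_eq_iff_of_sigmaFinite (measurable_const.indicator hA0).aemeasurable
      hf0.aemeasurable, ← heq]
    exact withDensity_indicator_one hA0
  refine ⟨f ⁻¹' {1}, hf (measurableSet_singleton 1), ?_⟩
  rw [measure_symmDiff_eq_zero_iff]
  filter_upwards [heq2] with x hx
  apply propext
  change x ∈ A ↔ f x = 1
  rw [← hx]
  by_cases hxA : x ∈ A <;> simp [hxA]
end
end

/-- Every tail event of a transient partially exchangeable process with
non-random initial state agrees up to a null set with an event measurable with respect to the
sigma-algebra generated by the transition numbers. -/
theorem stmt1 {S : Type} [Countable S] [MeasurableSpace S] [DiscreteMeasurableSpace S]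
    (μ : Measure (ℕ → S)) (hprob : μ Set.univ = 1)
    (hPE : PartiallyExchangeable μ)
    (htrans : μ {x | ∀ s : S, {i : ℕ | x i = s}.Finite} = 1)
    (s0 : S) (h0 : μ {x | x 0 = s0} = 1)
    (A : Set (ℕ → S)) (hA : MeasurableSet[tailSigma S] A) :
    ∃ B : Set (ℕ → S), MeasurableSet[transSigma S] B ∧ μ (symmDiff A B) = 0 := by
  have : IsProbabilityMeasure μ := ⟨hprob⟩
  have hms : MeasurableSet {x : ℕ → S | ∀ s : S, {i : ℕ | x i = s}.Finite} := by
    have e : {x : ℕ → S | ∀ s : S, {i : ℕ | x i = s}.Finite} =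
        ⋂ s : S, ⋃ N : ℕ, ⋂ i : ℕ, ⋂ (_ : N ≤ i), {x : ℕ → S | x i = s}ᶜ := by
      ext x
      simp only [mem_ofPred_eq, mem_iInter, mem_iUnion, mem_compl_iff]
      refine forall_congr' fun s => ?_
      constructor
      · intro hs
        obtain ⟨N, hN⟩ := hs.bddAbove
        exact ⟨N + 1, fun i hi hx => by have := hN hx; omega⟩
      · rintro ⟨N, hN⟩
        refine (Set.finite_lt_nat N).subset fun i hi => ?_
        by_contra hc
        exact hN i (not_lt.1 hc) hi
    rw [e]
    refine MeasurableSet.iInter fun s => MeasurableSet.iUnion fun N =>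
      MeasurableSet.iInter fun i => MeasurableSet.iInter fun _ => MeasurableSet.compl ?_
    exact (measurableSet_singleton s).preimage (measurable_pi_apply (X := fun _ : ℕ => S) i)
  have hm0 : MeasurableSet {x : ℕ → S | x 0 = s0} :=
    (measurableSet_singleton s0).preimage (measurable_pi_apply (X := fun _ : ℕ => S) 0)
  have hTr : ∀ᵐ x ∂μ, Tr x := (mem_ae_iff_prob_eq_one₀ hms.nullMeasurableSet).2 htrans
  have h0' : ∀ᵐ x ∂μ, x 0 = s0 := (mem_ae_iff_prob_eq_one₀ hm0.nullMeasurableSet).2 h0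
  exact stmt_aux μ hPE hTr s0 h0' A hA

end DF
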